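/- arXiv:math/9911081 — 14 statements merged into one kernel-verified Lean document; each statement's English description precedes it below -/
import Mathlib

section
/- Let P : A → A be the unique linear endomorphism of A satisfying p(P(a)) = tr(s ∘ ℓ(p) ∘ s ∘ r(a)) for all p ∈ A* and a ∈ A. Then P is an integral and cointegral for A, i.e. P(a₍₁₎) ⊗ a₍₂₎ = P(a) ⊗ 1 in A ⊗ A and P(a)·b = ε(b)·P(a) for all a, b ∈ A, and moreover tr(P) = 1. -/
open TensorProduct LinearMap HopfAlgebra Coalgebra

namespace HopfAlgebra

open WithConv Module

section Convolution

variable {k A B : Type*} [Field k] [Ring A] [HopfAlgebra k A] [Ring B] [Algebra k B]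

/-- A functional on `A`, regarded as an element of the convolution algebra of `A`. -/
noncomputable def scalarConv (p : Dual k A) : WithConv (A →ₗ[k] A) :=
  toConv (Algebra.linearMap k A ∘ₗ p)

/-- The operator `a ↦ a₍₁₎ p(a₍₂₎)`. -/
noncomputable def rightHit (p : Dual k A) : A →ₗ[k] A :=
  (TensorProduct.rid k A).toLinearMap ∘ₗ p.lTensor A ∘ₗ comul (R := k)

lemma convMul_scalarConv_apply (X : WithConv (A →ₗ[k] A)) (p : Dual k A) (x : A) :
    (X * scalarConv p) x =
      ∑ i ∈ (ℛ k x).index, p ((ℛ k x).right i) • X ((ℛ k x).left i) := by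
  rw [(ℛ k x).convMul_apply]
  refine Finset.sum_congr rfl fun i _ => ?_
  simp [scalarConv, Algebra.smul_def, Algebra.commutes]

lemma scalarConv_convMul_apply (X : WithConv (A →ₗ[k] A)) (p : Dual k A) (x : A) :
    (scalarConv p * X) x =
      ∑ i ∈ (ℛ k x).index, p ((ℛ k x).left i) • X ((ℛ k x).right i) := by
  rw [(ℛ k x).convMul_apply]
  refine Finset.sum_congr rfl fun i _ => ?_
  simp [scalarConv, Algebra.smul_def]

lemma rightHit_apply (p : Dual k A) (x : A) :
    rightHit p x = ∑ i ∈ (ℛ k x).index, p ((ℛ k x).right i) • (ℛ k x).left i := by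
  have h := congr((TensorProduct.rid k A) (p.lTensor A $((ℛ k x).eq)))
  simpa [rightHit] using h.symm

lemma comp_rightHit (X : A →ₗ[k] A) (p : Dual k A) :
    toConv (X ∘ₗ rightHit p) = toConv X * scalarConv p := by
  ext x
  rw [convMul_scalarConv_apply]
  simp [rightHit_apply]

lemma comp_convMul_scalarConv (f X : A →ₗ[k] A) (p : Dual k A) :
    toConv (f ∘ₗ (toConv X * scalarConv p).ofConv) = toConv (f ∘ₗ X) * scalarConv p := by
  ext x
  have := congr(f $(convMul_scalarConv_apply (toConv X) p x))
  rw [convMul_scalarConv_apply]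
  simpa using this

lemma comul_eq_convMul :
    toConv (comul (R := k) (A := A)) =
      toConv ((TensorProduct.mk k A A).flip 1) * toConv (TensorProduct.mk k A A 1) := by
  ext x
  rw [(ℛ k x).convMul_apply]
  simpa using (ℛ k x).eq.symm

lemma comul_antipode_conv :
    toConv (comul ∘ₗ antipode k (A := A)) =
      toConv ((TensorProduct.mk k A A 1) ∘ₗ antipode k) *
        toConv ((TensorProduct.mk k A A).flip 1 ∘ₗ antipode k) := by
  have h1 : toConv ((TensorProduct.mk k A A).flip 1 ∘ₗ antipode k) *
      toConv ((TensorProduct.mk k A A).flip 1) = 1 := by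
    ext x
    rw [(ℛ k x).convMul_apply]
    simp [← TensorProduct.sum_tmul, sum_antipode_mul_eq_algebraMap_counit]
  have h2 : toConv ((TensorProduct.mk k A A 1) ∘ₗ antipode k) *
      toConv (TensorProduct.mk k A A 1) = 1 := by
    ext x
    rw [(ℛ k x).convMul_apply]
    simp [← TensorProduct.tmul_sum, sum_antipode_mul_eq_algebraMap_counit,
      Algebra.algebraMap_eq_smul_one, Algebra.TensorProduct.one_def]
  symm
  refine left_inv_eq_right_inv (a := toConv (comul (R := k) (A := A))) ?_ comul_right_inv
  rw [comul_eq_convMul, mul_assoc, ← mul_assoc (toConv ((TensorProduct.mk k A A).flip 1 ∘ₗ antipode k)), h1,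
    one_mul, h2]

lemma comul_antipode (x : A) :
    comul (R := k) (antipode k x) = ∑ i ∈ (ℛ k x).index,
      antipode k ((ℛ k x).right i) ⊗ₜ[k] antipode k ((ℛ k x).left i) := by
  have h := congr($(comul_antipode_conv (k := k) (A := A)) x)
  rw [(ℛ k x).convMul_apply] at h
  simpa using h

lemma sum_comul_antipode {M : Type*} [AddCommGroup M] [Module k M] (f : A ⊗[k] A →ₗ[k] M) (x : A) :
    ∑ i ∈ (ℛ k (antipode k x)).index, f ((ℛ k (antipode k x)).left i ⊗ₜ
      (ℛ k (antipode k x)).right i) =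
    ∑ i ∈ (ℛ k x).index,
      f (antipode k ((ℛ k x).right i) ⊗ₜ[k] antipode k ((ℛ k x).left i)) := by
  rw [← map_sum, ← map_sum, ← comul_antipode, (ℛ k _).eq]

lemma rightHit_antipode (q : Dual k A) :
    toConv (rightHit q ∘ₗ antipode k) =
      scalarConv (q ∘ₗ antipode k) * toConv (antipode k (A := A)) := by
  ext x
  rw [scalarConv_convMul_apply]
  simp [rightHit, comul_antipode]

lemma convMul_comp_antipode (X : A →ₗ[k] A) (q : Dual k A) :
    toConv ((scalarConv q * toConv X).ofConv ∘ₗ antipode k) =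
      toConv (X ∘ₗ antipode k) * scalarConv (q ∘ₗ antipode k) := by
  ext x
  have h := sum_comul_antipode
    ((LinearMap.mul' k A) ∘ₗ TensorProduct.map (Algebra.linearMap k A ∘ₗ q) X) x
  simp only [LinearMap.comp_apply, TensorProduct.map_tmul, LinearMap.mul'_apply,
    Algebra.linearMap_apply, ← Algebra.smul_def] at h
  rw [convMul_scalarConv_apply]
  have h' := scalarConv_convMul_apply (toConv X) q (antipode k x)
  simpa [h] using h'


lemma rightHit_comp_antipode_rightHit_antipode (p q : Dual k A) :
    toConv (rightHit q ∘ₗ antipode k ∘ₗ rightHit p ∘ₗ antipode k) =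
      toConv (antipode k ∘ₗ rightHit p ∘ₗ antipode k (A := A)) *
        scalarConv (q ∘ₗ antipode k ∘ₗ antipode k) := by
  have h : rightHit q ∘ₗ antipode k ∘ₗ rightHit p =
      (scalarConv (q ∘ₗ antipode k) * toConv (antipode k (A := A) ∘ₗ rightHit p)).ofConv := by
    have := comp_convMul_scalarConv (rightHit q) (antipode k (A := A)) p
    rw [rightHit_antipode, mul_assoc, ← comp_rightHit] at this
    simpa using congr(ofConv $this)
  have := convMul_comp_antipode (antipode k (A := A) ∘ₗ rightHit p) (q ∘ₗ antipode k)
  rw [← h] at this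
  simpa only [LinearMap.comp_assoc] using this

lemma convMul_comp_mulRight (f g : A →ₗ[k] B) (a : A) :
    toConv ((toConv f * toConv g).ofConv ∘ₗ mulRight k a) = ∑ i ∈ (ℛ k a).index,
      toConv (f ∘ₗ mulRight k ((ℛ k a).left i)) * toConv (g ∘ₗ mulRight k ((ℛ k a).right i)) := by
  ext x
  have h : (toConv f * toConv g) (x * a) = ∑ i ∈ (ℛ k a).index, ∑ j ∈ (ℛ k x).index,
      f ((ℛ k x).left j * (ℛ k a).left i) * g ((ℛ k x).right j * (ℛ k a).right i) := by
    rw [((ℛ k x).mul (ℛ k a)).convMul_apply, Finset.sum_comm]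
    simp [Finset.sum_product]
  trans (toConv f * toConv g) (x * a)
  · rfl
  · rw [h, WithConv.ofConv_sum, LinearMap.sum_apply]
    refine Finset.sum_congr rfl fun i _ => ?_
    symm
    exact (ℛ k x).convMul_apply (toConv (f ∘ₗ mulRight k ((ℛ k a).left i)))
      (toConv (g ∘ₗ mulRight k ((ℛ k a).right i)))

lemma convMul_comp_mulLeft (f g : A →ₗ[k] B) (a : A) :
    toConv ((toConv f * toConv g).ofConv ∘ₗ mulLeft k a) = ∑ i ∈ (ℛ k a).index,
      toConv (f ∘ₗ mulLeft k ((ℛ k a).left i)) * toConv (g ∘ₗ mulLeft k ((ℛ k a).right i)) := by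
  ext x
  have h : (toConv f * toConv g) (a * x) = ∑ i ∈ (ℛ k a).index, ∑ j ∈ (ℛ k x).index,
      f ((ℛ k a).left i * (ℛ k x).left j) * g ((ℛ k a).right i * (ℛ k x).right j) := by
    rw [((ℛ k a).mul (ℛ k x)).convMul_apply]
    simp [Finset.sum_product]
  trans (toConv f * toConv g) (a * x)
  · rfl
  · rw [h, WithConv.ofConv_sum, LinearMap.sum_apply]
    refine Finset.sum_congr rfl fun i _ => ?_
    symm
    exact (ℛ k x).convMul_apply (toConv (f ∘ₗ mulLeft k ((ℛ k a).left i)))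
      (toConv (g ∘ₗ mulLeft k ((ℛ k a).right i)))

lemma id_convMul_antipode_mulLeft (a : A) :
    toConv LinearMap.id * toConv (antipode k ∘ₗ mulLeft k a) =
      toConv (counit.smulRight (antipode k a) : A →ₗ[k] A) := by
  ext x
  rw [(ℛ k x).convMul_apply]
  simp [antipode_mul_antidistrib, ← mul_assoc, ← Finset.sum_mul,
    sum_mul_antipode_eq_algebraMap_counit, Algebra.smul_def]

lemma counit_smulRight_convMul (a : A) (f : A →ₗ[k] A) :
    toConv (counit.smulRight a : A →ₗ[k] A) * toConv f = toConv (mulLeft k a ∘ₗ f) := by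
  ext x
  rw [(ℛ k x).convMul_apply]
  have := congr(a * f $(sum_counit_smul (ℛ k x)))
  simpa [Finset.mul_sum] using this

/-- `s ∘ ℓ(b · p)` in terms of `s ∘ ℓ(p)`. -/
lemma antipode_rightHit_comp_mulRight (p : Dual k A) (b y : A) :
    antipode k (rightHit (p ∘ₗ mulRight k b) y) = ∑ i ∈ (ℛ k b).index,
      (ℛ k b).left i * antipode k (rightHit p (y * (ℛ k b).right i)) := by
  have h : toConv LinearMap.id * toConv ((antipode k ∘ₗ rightHit p) ∘ₗ mulLeft k y) =
      ∑ i ∈ (ℛ k y).index, toConv (mulLeft k (antipode k ((ℛ k y).left i)) ∘ₗ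
        Algebra.linearMap k A ∘ₗ p ∘ₗ mulLeft k ((ℛ k y).right i)) := by
    have := comp_rightHit (antipode k (A := A)) p
    have h2 := convMul_comp_mulLeft (antipode k (A := A)) (Algebra.linearMap k A ∘ₗ p) y
    change toConv ((toConv (antipode k (A := A)) * scalarConv p).ofConv ∘ₗ _) = _ at h2
    rw [← this] at h2
    rw [h2, Finset.mul_sum]
    refine Finset.sum_congr rfl fun i _ => ?_
    rw [← mul_assoc, id_convMul_antipode_mulLeft, counit_smulRight_convMul, LinearMap.comp_assoc]
  have h' := congr($h b)
  rw [(ℛ k b).convMul_apply, WithConv.ofConv_sum, LinearMap.sum_apply] at h'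
  simp only [LinearMap.comp_apply, LinearMap.id_apply, mulLeft_apply] at h'
  rw [h']
  simp [rightHit_apply, Algebra.algebraMap_eq_smul_one]


lemma comul_convMul_antipode :
    toConv (comul (R := k) (A := A)) * toConv (TensorProduct.mk k A A 1 ∘ₗ antipode k) =
      toConv ((TensorProduct.mk k A A).flip 1) := by
  have h : toConv (TensorProduct.mk k A A 1) *
      toConv ((TensorProduct.mk k A A 1) ∘ₗ antipode k) = 1 := by
    ext x
    rw [(ℛ k x).convMul_apply]
    simp [← TensorProduct.tmul_sum, sum_mul_antipode_eq_algebraMap_counit,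
      Algebra.algebraMap_eq_smul_one, Algebra.TensorProduct.one_def]
  rw [comul_eq_convMul, mul_assoc, h, mul_one]

/-- Moving a factor across the coproduct of a right integral. -/
lemma comul_mul_tmul_one {Λ : A} (hΛ : ∀ b, Λ * b = counit (R := k) b • Λ) (b : A) :
    comul (R := k) Λ * (b ⊗ₜ 1) = comul (R := k) Λ * (1 ⊗ₜ antipode k b) := by
  have h := congr($(comul_convMul_antipode (k := k) (A := A)) b)
  rw [(ℛ k b).convMul_apply] at h
  have h2 := congr(comul (R := k) Λ * (1 ⊗ₜ[k] antipode k $(sum_counit_smul (R := k) (ℛ k b))))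
  replace h : ∑ i ∈ (ℛ k b).index, comul (R := k) ((ℛ k b).left i) *
    (1 ⊗ₜ[k] antipode k ((ℛ k b).right i)) = b ⊗ₜ 1 := by simpa using h
  rw [← h, ← h2, Finset.mul_sum, map_sum, TensorProduct.tmul_sum, Finset.mul_sum]
  refine Finset.sum_congr rfl fun i _ => ?_
  rw [← mul_assoc, ← Bialgebra.comul_mul, hΛ]
  simp

lemma sum_left_mul_antipode_rightHit (p : Dual k A) (x : A) :
    ∑ i ∈ (ℛ k x).index, (ℛ k x).left i * antipode k (rightHit p ((ℛ k x).right i)) =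
      algebraMap k A (p x) := by
  have h : toConv LinearMap.id * toConv (antipode k ∘ₗ rightHit p) = scalarConv p := by
    rw [comp_rightHit, ← mul_assoc, id_mul_antipode, one_mul]
  have h' := congr($h x)
  rw [(ℛ k x).convMul_apply] at h'
  simpa [scalarConv] using h'

lemma scalarConv_convMul_scalarConv_apply (p q : Dual k A) (x : A) :
    (scalarConv p * scalarConv q) x =
      (∑ i ∈ (ℛ k x).index, p ((ℛ k x).left i) * q ((ℛ k x).right i)) • (1 : A) := by
  rw [scalarConv_convMul_apply, Finset.sum_smul]
  simp [scalarConv, Algebra.algebraMap_eq_smul_one, smul_smul]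

lemma sum_scalarConv_antipode_mul_scalarConv {ι : Type*} [Fintype ι] (v : Basis ι k A)
    (q : Dual k A) :
    ∑ m, scalarConv (q ∘ₗ mulRight k (v m) ∘ₗ antipode k) * scalarConv (v.coord m) =
      toConv (q 1 • (1 : WithConv (A →ₗ[k] A)).ofConv) := by
  ext x
  have h (y z : A) : ∑ m, q (y * v m) * v.repr z m = q (y * z) := by
    conv_rhs => rw [← v.sum_repr z]
    simp only [Finset.mul_sum, map_sum, mul_smul_comm, map_smul, smul_eq_mul, mul_comm]
  rw [WithConv.ofConv_sum, LinearMap.sum_apply]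
  simp only [scalarConv_convMul_scalarConv_apply]
  rw [← Finset.sum_smul, Finset.sum_comm]
  simp only [LinearMap.comp_apply, Basis.coord_apply, mulRight_apply, h, ← map_sum,
    sum_antipode_mul_eq_smul]
  simp [Algebra.algebraMap_eq_smul_one, smul_smul, mul_comm]

lemma sum_scalarConv_mul_scalarConv_antipode {ι : Type*} [Fintype ι] (v : Basis ι k A)
    (q : Dual k A) (c : A) :
    ∑ m, scalarConv (v.coord m ∘ₗ antipode k ∘ₗ antipode k ∘ₗ mulRight k c) *
        scalarConv (q ∘ₗ mulRight k (v m) ∘ₗ antipode k) =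
      toConv (q (antipode k (antipode k c)) • (1 : WithConv (A →ₗ[k] A)).ofConv) := by
  ext x
  have h (y z : A) : ∑ m, v.repr z m * q (y * v m) = q (y * z) := by
    conv_rhs => rw [← v.sum_repr z]
    simp only [Finset.mul_sum, map_sum, mul_smul_comm, map_smul, smul_eq_mul]
  rw [WithConv.ofConv_sum, LinearMap.sum_apply]
  simp only [scalarConv_convMul_scalarConv_apply]
  rw [← Finset.sum_smul, Finset.sum_comm]
  simp only [LinearMap.comp_apply, Basis.coord_apply, mulRight_apply, h, ← map_sum,
    ← antipode_mul_antidistrib]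
  simp only [antipode_mul_antidistrib (_ : A) c, mul_assoc, ← Finset.mul_sum,
    sum_antipode_mul_eq_smul]
  simp [Algebra.algebraMap_eq_smul_one, smul_smul, mul_comm]

variable [FiniteDimensional k A]

/-- The existence of a nonzero right integral makes the antipode injective. -/
lemma antipode_injective_of_integral {Λ : A} (h0 : Λ ≠ 0)
    (hΛ : ∀ b, Λ * b = counit (R := k) b • Λ) : Function.Injective (antipode k (A := A)) := by
  rw [injective_iff_map_eq_zero]
  intro b hb
  obtain ⟨p, hp⟩ : ∃ p : Dual k A, p Λ ≠ 0 := by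
    by_contra! h
    exact h0 ((Module.forall_dual_apply_eq_zero_iff k Λ).1 h)
  have h1 (e : A) : comul (R := k) Λ * ((e * b) ⊗ₜ 1) = 0 := by
    rw [comul_mul_tmul_one hΛ, antipode_mul_antidistrib, hb, zero_mul, TensorProduct.tmul_zero,
      mul_zero]
  have h2 (e : A) (φ : Dual k A) :
      ∑ i ∈ (ℛ k Λ).index, φ ((ℛ k Λ).right i) • ((ℛ k Λ).left i * (e * b)) = 0 := by
    have := congr((TensorProduct.rid k A) (φ.lTensor A $(h1 e)))
    rw [← (ℛ k Λ).eq, Finset.sum_mul] at this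
    simpa using this
  let v := Module.finBasis k A
  have h3 : ∑ i ∈ (ℛ k Λ).index, (ℛ k Λ).left i * antipode k (rightHit p ((ℛ k Λ).right i)) * b
      = 0 := by
    calc _ = ∑ i ∈ (ℛ k Λ).index, ∑ m, v.repr (antipode k (rightHit p ((ℛ k Λ).right i))) m •
          ((ℛ k Λ).left i * (v m * b)) := by
          refine Finset.sum_congr rfl fun i _ => ?_
          conv_lhs => rw [← v.sum_repr (antipode k (rightHit p ((ℛ k Λ).right i)))]
          simp only [Finset.mul_sum, Finset.sum_mul, mul_assoc, smul_mul_assoc, mul_smul_comm]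
      _ = 0 := by
          rw [Finset.sum_comm]
          exact Finset.sum_eq_zero fun m _ =>
            h2 (v m) (v.coord m ∘ₗ antipode k ∘ₗ rightHit p)
  rw [← Finset.sum_mul, sum_left_mul_antipode_rightHit, ← Algebra.smul_def] at h3
  exact (smul_eq_zero.1 h3).resolve_left hp

lemma sum_smul_trace_antipode_rightHit (p q : Dual k A) (a : A) :
    ∑ i ∈ (ℛ k a).index, q (antipode k (antipode k ((ℛ k a).right i))) •
        trace k A (antipode k ∘ₗ rightHit p ∘ₗ antipode k ∘ₗ mulRight k ((ℛ k a).left i)) =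
      q 1 • trace k A (antipode k ∘ₗ rightHit p ∘ₗ antipode k ∘ₗ mulRight k a) := by
  let v := Module.finBasis k A
  let H := antipode k ∘ₗ rightHit p ∘ₗ antipode k (A := A)
  let N (m) : A →ₗ[k] A := rightHit (q ∘ₗ mulRight k (v m) ∘ₗ antipode k)
  let M (m) : A →ₗ[k] A := rightHit (v.coord m)
  have hNM : ∑ m, N m ∘ₗ M m = q 1 • LinearMap.id := by
    apply WithConv.toConv_injective
    rw [WithConv.toConv_sum]
    have hm m : toConv (N m ∘ₗ M m) = toConv LinearMap.id *
        (scalarConv (q ∘ₗ mulRight k (v m) ∘ₗ antipode k) * scalarConv (v.coord m)) := by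
      rw [comp_rightHit, ← mul_assoc, ← comp_rightHit LinearMap.id]
      rfl
    simp_rw [hm]
    rw [← Finset.mul_sum, sum_scalarConv_antipode_mul_scalarConv, WithConv.toConv_smul,
      mul_smul_comm, WithConv.toConv_ofConv, mul_one, WithConv.toConv_smul]
  have hMN : ∑ m, (M m ∘ₗ H ∘ₗ mulRight k a) ∘ₗ N m = ∑ i ∈ (ℛ k a).index,
      q (antipode k (antipode k ((ℛ k a).right i))) • (H ∘ₗ mulRight k ((ℛ k a).left i)) := by
    apply WithConv.toConv_injective
    rw [WithConv.toConv_sum, WithConv.toConv_sum]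
    have hm m : toConv ((M m ∘ₗ H ∘ₗ mulRight k a) ∘ₗ N m) = ∑ i ∈ (ℛ k a).index,
        toConv (H ∘ₗ mulRight k ((ℛ k a).left i)) *
        (scalarConv (v.coord m ∘ₗ antipode k ∘ₗ antipode k ∘ₗ mulRight k ((ℛ k a).right i)) *
          scalarConv (q ∘ₗ mulRight k (v m) ∘ₗ antipode k)) := by
      rw [comp_rightHit]
      have h1 := rightHit_comp_antipode_rightHit_antipode p (v.coord m)
      have h2 := convMul_comp_mulRight H
        (Algebra.linearMap k A ∘ₗ v.coord m ∘ₗ antipode k ∘ₗ antipode k) a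
      change toConv ((toConv H * scalarConv _).ofConv ∘ₗ _) = _ at h2
      rw [← h1] at h2
      change toConv (M m ∘ₗ H ∘ₗ mulRight k a) = _ at h2
      rw [h2, Finset.sum_mul]
      exact Finset.sum_congr rfl fun i _ => mul_assoc _ _ _
    simp_rw [hm]
    rw [Finset.sum_comm]
    refine Finset.sum_congr rfl fun i _ => ?_
    rw [← Finset.mul_sum, sum_scalarConv_mul_scalarConv_antipode, WithConv.toConv_smul,
      mul_smul_comm, WithConv.toConv_ofConv, mul_one, WithConv.toConv_smul]
  have h := congr(trace k A $hMN)
  simp only [map_sum, map_smul] at h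
  calc _ = ∑ m, trace k A ((M m ∘ₗ H ∘ₗ mulRight k a) ∘ₗ N m) := h.symm
    _ = ∑ m, trace k A ((N m ∘ₗ M m) ∘ₗ H ∘ₗ mulRight k a) :=
      Finset.sum_congr rfl fun m _ => LinearMap.trace_comp_comm' _ _
    _ = q 1 • trace k A (H ∘ₗ mulRight k a) := by
      have hX : ∑ m, (N m ∘ₗ M m) ∘ₗ H ∘ₗ mulRight k a = q 1 • (H ∘ₗ mulRight k a) := by
        ext x
        simpa [LinearMap.sum_apply] using congr($hNM ((H ∘ₗ mulRight k a) x))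
      rw [← map_sum, hX, map_smul]

section Trace

variable (P : A →ₗ[k] A)
    (hP : ∀ (p : Dual k A) (a : A), p (P a) = trace k A
      (antipode k ∘ₗ rightHit p ∘ₗ antipode k ∘ₗ mulRight k a))

include hP

lemma mul_eq_counit_smul_of_trace (a b : A) : P a * b = counit (R := k) b • P a := by
  rw [← sub_eq_zero, ← Module.forall_dual_apply_eq_zero_iff k]
  intro p
  rw [map_sub, sub_eq_zero, map_smul, hP]
  have h : antipode k ∘ₗ rightHit (p ∘ₗ mulRight k b) ∘ₗ antipode k ∘ₗ mulRight k a =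
      ∑ i ∈ (ℛ k b).index, mulLeft k ((ℛ k b).left i) ∘ₗ
        (antipode k ∘ₗ rightHit p ∘ₗ mulRight k ((ℛ k b).right i) ∘ₗ antipode k ∘ₗ
          mulRight k a) := by
    ext x
    simp [antipode_rightHit_comp_mulRight, LinearMap.sum_apply]
  have h' : ∑ i ∈ (ℛ k b).index,
      (antipode k ∘ₗ rightHit p ∘ₗ mulRight k ((ℛ k b).right i) ∘ₗ antipode k ∘ₗ
          mulRight k a) ∘ₗ mulLeft k ((ℛ k b).left i) = counit (R := k) b •
      (antipode k ∘ₗ rightHit p ∘ₗ antipode k ∘ₗ mulRight k a) := by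
    ext x
    simp only [LinearMap.sum_apply, LinearMap.comp_apply, mulLeft_apply, mulRight_apply,
      ← map_sum, LinearMap.smul_apply, ← map_smul]
    congr 2
    simp [mul_assoc, antipode_mul_antidistrib, ← Finset.mul_sum, sum_antipode_mul_eq_smul]
  calc p (P a * b) = (p ∘ₗ mulRight k b) (P a) := rfl
    _ = _ := by
      rw [hP, h, map_sum]
      rw [Finset.sum_congr rfl fun i _ => LinearMap.trace_comp_comm' _ _, ← map_sum, h', map_smul]

lemma trace_eq_one_of_trace : trace k A P = 1 := by
  let v := Module.finBasis k A
  let W : A →ₗ[k] A ⊗[k] A := (antipode k).rTensor A ∘ₗ comul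
  let S : A ⊗[k] A →ₗ[k] A := antipode k ∘ₗ LinearMap.mul' k A
  have h1 : S ∘ₗ W = (counit (R := k) (A := A)).smulRight 1 := by
    ext x
    simp [S, W, Algebra.algebraMap_eq_smul_one]
  have h2 (i j) (y : A) : (v.tensorProduct v).repr (W y) (j, i) =
      v.repr (antipode k (rightHit (v.coord i) y)) j := by
    simp only [W, LinearMap.comp_apply, rightHit_apply, ← (ℛ k y).eq]
    simp
  have h3 : trace k A P = trace k (A ⊗[k] A) (W ∘ₗ S) := by
    rw [LinearMap.trace_eq_matrix_trace k v, LinearMap.trace_eq_matrix_trace k (v.tensorProduct v)]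
    simp only [Matrix.trace, Matrix.diag_apply, LinearMap.toMatrix_apply, Fintype.sum_prod_type]
    rw [Finset.sum_comm]
    refine Finset.sum_congr rfl fun i _ => ?_
    rw [← Basis.coord_apply, hP, LinearMap.trace_eq_matrix_trace k v]
    simp [Matrix.trace, LinearMap.toMatrix_apply, h2, S]
  rw [h3, LinearMap.trace_comp_comm', h1]
  simp [LinearMap.trace_smulRight]

lemma rTensor_comul_of_trace (a : A) : P.rTensor A (comul (R := k) a) = P a ⊗ₜ[k] (1 : A) := by
  have hinj : Function.Injective (antipode k (A := A)) := by
    have hP0 : P ≠ 0 := by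
      rintro rfl
      simpa using trace_eq_one_of_trace 0 hP
    obtain ⟨c, hc⟩ := DFunLike.ne_iff.1 hP0
    exact antipode_injective_of_integral hc (mul_eq_counit_smul_of_trace P hP c)
  let e := LinearEquiv.ofInjectiveEndo (antipode k (A := A)) hinj
  have h1 (q : Dual k A) :
      ∑ i ∈ (ℛ k a).index, q ((ℛ k a).right i) • P ((ℛ k a).left i) = q 1 • P a := by
    rw [← sub_eq_zero, ← Module.forall_dual_apply_eq_zero_iff k]
    intro p
    have h := sum_smul_trace_antipode_rightHit p
      (q ∘ₗ e.symm.toLinearMap ∘ₗ e.symm.toLinearMap) a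
    have he (x) : e.symm (antipode k x) = x := e.symm_apply_apply x
    have he1 : e.symm 1 = 1 := by simpa using he 1
    simp only [LinearMap.comp_apply, LinearEquiv.coe_coe, he, he1, ← hP] at h
    rw [map_sub, sub_eq_zero, map_sum, map_smul, ← h]
    simp
  let v := Module.finBasis k A
  have h2 (x y : A) : x ⊗ₜ[k] y = ∑ m, (v.coord m y • x) ⊗ₜ v m := by
    conv_lhs => rw [← v.sum_repr y]
    simp only [TensorProduct.tmul_sum, TensorProduct.smul_tmul, Basis.coord_apply]
  rw [← (ℛ k a).eq, map_sum]
  simp only [LinearMap.rTensor_tmul]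
  rw [h2 (P a)]
  simp_rw [h2 (P ((ℛ k a).left _)), ← h1]
  rw [Finset.sum_comm]
  simp [TensorProduct.sum_tmul]

end Trace

end Convolution
end HopfAlgebra

/-- Let `A` be a finite-dimensional Hopf algebra over a field `k` with antipode
`s`, and let `P : A → A` be the (unique) linear endomorphism satisfying
`p (P a) = tr (s ∘ ℓ(p) ∘ s ∘ r(a))` for all `p ∈ A*`, `a ∈ A`, where `ℓ(p) b = b₍₁₎ p(b₍₂₎)`
and `r(a) b = b * a`.  Then `P` is an integral and cointegral for `A`, i.e.
`P(a₍₁₎) ⊗ a₍₂₎ = P a ⊗ 1` and `P a * b = ε(b) • P a` for all `a b`, and moreover `tr P = 1`. -/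
theorem stmt0 (k A : Type*) [Field k] [Ring A] [HopfAlgebra k A] [FiniteDimensional k A]
    (P : A →ₗ[k] A)
    (hP : ∀ (p : Module.Dual k A) (a : A),
      p (P a) = LinearMap.trace k A
        (antipode (R := k) ∘ₗ
          ((TensorProduct.rid k A).toLinearMap ∘ₗ p.lTensor A ∘ₗ comul (R := k)) ∘ₗ
          antipode (R := k) ∘ₗ LinearMap.mulRight k a)) :
    (∀ a : A, P.rTensor A (comul (R := k) a) = P a ⊗ₜ[k] (1 : A)) ∧
    (∀ a b : A, P a * b = counit (R := k) b • P a) ∧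
    LinearMap.trace k A P = 1 := by
  exact ⟨HopfAlgebra.rTensor_comul_of_trace P hP, HopfAlgebra.mul_eq_counit_smul_of_trace P hP,
    HopfAlgebra.trace_eq_one_of_trace P hP⟩
end

section
/- Integrals and cointegrals for A are unique up to scalar multiple: if 𝒫 and 𝒫' are endomorphisms of A that are both integrals and cointegrals for A and 𝒫 ≠ 0, then 𝒫' = α·𝒫 for some scalar α ∈ k. Equivalently, the subspace of End(A) consisting of integrals and cointegrals for A is at most one-dimensional. -/
open TensorProduct LinearMap HopfAlgebra Coalgebra

section

variable {k A : Type*} [Field k] [Ring A] [HopfAlgebra k A]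

/-- The identity `∑ b₍₁₎ ⊗ b₍₂₎ s(b₍₃₎) = b ⊗ 1`, for a decomposition of `Δ(b)`. -/
lemma sum_comul_mul_one_tmul_antipode (b : A) {ι : Type*} (r : Repr k b ι) :
    ∑ i ∈ r.index, comul (R := k) (r.left i) * (1 : A) ⊗ₜ[k] antipode k (r.right i) =
      b ⊗ₜ[k] (1 : A) := by
  have key (x y : A) : comul (R := k) x * (1 : A) ⊗ₜ[k] antipode k y =
      (LinearMap.mul' k A ∘ₗ (antipode k).lTensor A).lTensor A
        (TensorProduct.assoc k A A A ((comul (R := k)).rTensor A (x ⊗ₜ[k] y))) := by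
    rw [rTensor_tmul]
    induction comul (R := k) x with
    | zero => simp
    | tmul u v => simp
    | add u v hu hv => simp only [add_mul, add_tmul, map_add, hu, hv]
  simp_rw [key, ← map_sum, r.eq, coassoc_apply]
  rw [← LinearMap.comp_apply, ← lTensor_comp, LinearMap.comp_assoc, mul_antipode_lTensor_comul,
    lTensor_comp, LinearMap.comp_apply, lTensor_counit_comul]
  simp

variable {l : A →ₗ[k] k}

/-- `∑ l(a₍₁₎ b) a₍₂₎ = ∑ l(a b₍₁₎) s(b₍₂₎)` for a cointegral `l`. -/
lemma lid_rTensor_comul_mul_tmul_one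
    (hl : ∀ a : A, l.rTensor A (comul (R := k) a) = l a ⊗ₜ[k] (1 : A))
    (a b : A) {ι : Type*} (r : Repr k b ι) :
    TensorProduct.lid k A (l.rTensor A (comul (R := k) a * b ⊗ₜ[k] (1 : A))) =
      ∑ i ∈ r.index, l (a * r.left i) • antipode k (r.right i) := by
  have mul_right (t : A ⊗[k] A) (c : A) :
      TensorProduct.lid k A (l.rTensor A (t * (1 : A) ⊗ₜ[k] c)) =
        TensorProduct.lid k A (l.rTensor A t) * c := by
    induction t with
    | zero => simp
    | tmul u v => simp
    | add u v hu hv => simp only [add_mul, map_add, hu, hv]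
  simp_rw [← sum_comul_mul_one_tmul_antipode b r, Finset.mul_sum, map_sum, ← mul_assoc,
    mul_right, ← Bialgebra.comul_mul, hl]
  simp

/-- If `l(a b) = 0` for all `b`, then `Δ(a)` has a decomposition whose left factors have the same
property. -/
lemma exists_repr_forall_cointegral_mul_eq_zero
    (hl : ∀ a : A, l.rTensor A (comul (R := k) a) = l a ⊗ₜ[k] (1 : A))
    {a : A} (ha : ∀ b, l (a * b) = 0) :
    ∃ r : Repr k a (Module.Basis.ofVectorSpaceIndex k A),
      ∀ i ∈ r.index, ∀ b, l (r.left i * b) = 0 := by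
  classical
  let e := Module.Basis.ofVectorSpace k A
  obtain ⟨f, hf⟩ := (TensorProduct.equivFinsuppOfBasisRight (M := A) e).symm.surjective
    (comul (R := k) a)
  rw [TensorProduct.equivFinsuppOfBasisRight_symm_apply] at hf
  refine ⟨⟨f.support, f, e, hf⟩, fun i hi b ↦ ?_⟩
  have h := lid_rTensor_comul_mul_tmul_one hl a b (ℛ k b)
  simp only [ha, zero_smul, Finset.sum_const_zero, ← hf, Finsupp.sum, Finset.sum_mul, map_sum,
    Algebra.TensorProduct.tmul_mul_tmul, mul_one, rTensor_tmul, TensorProduct.lid_tmul] at h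
  exact linearIndependent_iff'.mp e.linearIndependent f.support _ h i hi

lemma counit_eq_zero_of_forall_cointegral_mul_eq_zero
    (hl : ∀ a : A, l.rTensor A (comul (R := k) a) = l a ⊗ₜ[k] (1 : A)) (hl0 : l ≠ 0)
    {a : A} (ha : ∀ b, l (a * b) = 0) : counit (R := k) a = 0 := by
  obtain ⟨r, hr⟩ := exists_repr_forall_cointegral_mul_eq_zero hl ha
  obtain ⟨c, hc⟩ := DFunLike.ne_iff.mp hl0
  have h : ∑ i ∈ r.index, l (r.left i * (antipode k (r.right i) * c)) =
      counit (R := k) a * l c := by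
    simp_rw [← mul_assoc, ← map_sum, ← Finset.sum_mul, sum_mul_antipode_eq_smul r]
    simp
  rw [Finset.sum_eq_zero fun i hi ↦ hr i hi _] at h
  exact (mul_eq_zero.mp h.symm).resolve_right hc

/-- The bilinear form `(a, b) ↦ l(a b)` of a nonzero cointegral `l` is nondegenerate on the left. -/
lemma eq_zero_of_forall_cointegral_mul_eq_zero
    (hl : ∀ a : A, l.rTensor A (comul (R := k) a) = l a ⊗ₜ[k] (1 : A)) (hl0 : l ≠ 0)
    {a : A} (ha : ∀ b, l (a * b) = 0) : a = 0 := by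
  obtain ⟨r, hr⟩ := exists_repr_forall_cointegral_mul_eq_zero hl ha
  rw [← sum_counit_smul r]
  refine Finset.sum_eq_zero fun i hi ↦ ?_
  rw [counit_eq_zero_of_forall_cointegral_mul_eq_zero hl hl0 (hr i hi), zero_smul]

/-- A nonzero cointegral does not vanish on a nonzero integral. -/
lemma cointegral_apply_integral_ne_zero
    (hl : ∀ a : A, l.rTensor A (comul (R := k) a) = l a ⊗ₜ[k] (1 : A)) (hl0 : l ≠ 0)
    {x : A} (hx : ∀ b, x * b = counit (R := k) b • x) (hx0 : x ≠ 0) : l x ≠ 0 := fun h ↦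
  hx0 <| eq_zero_of_forall_cointegral_mul_eq_zero hl hl0 fun b ↦ by simp [hx, h]

/-- Any two integrals are proportional, as soon as there is a nonzero cointegral. -/
lemma cointegral_smul_integral
    (hl : ∀ a : A, l.rTensor A (comul (R := k) a) = l a ⊗ₜ[k] (1 : A)) (hl0 : l ≠ 0)
    {x y : A} (hx : ∀ b, x * b = counit (R := k) b • x) (hy : ∀ b, y * b = counit (R := k) b • y) :
    l y • x = l x • y := by
  by_contra h
  refine cointegral_apply_integral_ne_zero hl hl0 (fun b ↦ ?_) (sub_ne_zero.mpr h)
    (by simp [mul_comm])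
  simp only [sub_mul, smul_mul_assoc, hx, hy, smul_sub, smul_comm (counit (R := k) b)]

end

/-- Integrals and cointegrals for a finite-dimensional Hopf algebra `A` (i.e.
endomorphisms `𝒫` with `𝒫(a₍₁₎) ⊗ a₍₂₎ = 𝒫 a ⊗ 1` and `𝒫 a * b = ε(b) • 𝒫 a` for all
`a b ∈ A`) are unique up to scalar multiple: if `𝒫` and `𝒫'` are both integrals and
cointegrals and `𝒫 ≠ 0`, then `𝒫' = α • 𝒫` for some `α ∈ k`. -/
theorem stmt1 (k A : Type*) [Field k] [Ring A] [HopfAlgebra k A] [FiniteDimensional k A]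
    (P P' : A →ₗ[k] A)
    (hP1 : ∀ a : A, P.rTensor A (comul (R := k) a) = P a ⊗ₜ[k] (1 : A))
    (hP2 : ∀ a b : A, P a * b = counit (R := k) b • P a)
    (hP'1 : ∀ a : A, P'.rTensor A (comul (R := k) a) = P' a ⊗ₜ[k] (1 : A))
    (hP'2 : ∀ a b : A, P' a * b = counit (R := k) b • P' a)
    (hP0 : P ≠ 0) :
    ∃ α : k, P' = α • P := by
  obtain ⟨c, hc⟩ := DFunLike.ne_iff.mp hP0
  rw [LinearMap.zero_apply] at hc
  obtain ⟨f, hf⟩ := Module.Projective.exists_dual_ne_zero k hc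
  have cointegral {Q : A →ₗ[k] A}
      (hQ : ∀ a : A, Q.rTensor A (comul (R := k) a) = Q a ⊗ₜ[k] (1 : A)) (a : A) :
      (f ∘ₗ Q).rTensor A (comul (R := k) a) = (f ∘ₗ Q) a ⊗ₜ[k] (1 : A) := by
    rw [rTensor_comp_apply, hQ, rTensor_tmul, LinearMap.comp_apply]
  have hl0 : f ∘ₗ P ≠ 0 := fun h ↦ hf congr($h c)
  have hlc : f (P (P c)) ≠ 0 :=
    cointegral_apply_integral_ne_zero (cointegral hP1) hl0 (hP2 c) hc
  -- every integral is a multiple of `P c`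
  have integral_eq {x : A} (hx : ∀ b, x * b = counit (R := k) b • x) :
      f (P c) • x = f x • P c := by
    have h := cointegral_smul_integral (cointegral hP1) hl0 hx (hP2 c)
    simp only [LinearMap.comp_apply] at h
    have hfx : f (P (P c)) * f x = f (P x) * f (P c) := by simpa using congr(f $h)
    refine smul_right_injective A hlc ?_
    simp only
    rw [smul_comm, h, smul_smul, smul_smul, hfx, mul_comm]
  -- the cointegrals `f ∘ P'` and `f ∘ P` are proportional
  have hprop : f (P (P c)) • (f ∘ₗ P') - f (P' (P c)) • (f ∘ₗ P) = 0 := by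
    by_contra h
    refine cointegral_apply_integral_ne_zero (fun a ↦ ?_) h (hP2 c) hc (by simp [mul_comm])
    simp only [rTensor_sub, rTensor_smul, LinearMap.sub_apply, LinearMap.smul_apply,
      cointegral hP1, cointegral hP'1, smul_tmul', sub_tmul]
  refine ⟨(f (P (P c)))⁻¹ * f (P' (P c)), LinearMap.ext fun a ↦ ?_⟩
  have h : f (P (P c)) * f (P' a) = f (P' (P c)) * f (P a) := by
    simpa [sub_eq_zero] using congr($hprop a)
  refine smul_right_injective A hf ?_
  simp only [LinearMap.smul_apply]
  rw [integral_eq (hP'2 a), smul_comm, integral_eq (hP2 a), smul_smul, mul_assoc, ← h,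
    inv_mul_cancel_left₀ hlc]
end

section
/- Let P : A → A be the unique linear endomorphism of A satisfying p(P(a)) = tr(s ∘ ℓ(p) ∘ s ∘ r(a)) for all p ∈ A* and a ∈ A. If λ ∈ A* is a right integral for A*, Λ ∈ A is a right integral for A, and λ(Λ) = 1, then P(a) = λ(a)·Λ for all a ∈ A. -/
open TensorProduct LinearMap HopfAlgebra Coalgebra

universe u v

section

variable {k : Type u} {A : Type v} [Field k] [Ring A] [HopfAlgebra k A]

/-- A right integral for the dual algebra, applied to a product through representations of the
comultiplications of both factors. -/
lemma sum_sum_integral_mul_smul_mul {ι κ : Type*} (lam : Module.Dual k A)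
    (hlam : ∀ a : A,
      (TensorProduct.lid k A) (lam.rTensor A (comul (R := k) a)) = lam a • (1 : A))
    {a b : A} (ra : Coalgebra.Repr k a ι) (rb : Coalgebra.Repr k b κ) :
    ∑ i ∈ ra.index, ∑ j ∈ rb.index,
      lam (ra.left i * rb.left j) • (ra.right i * rb.right j) = lam (a * b) • (1 : A) := by
  rw [← hlam (a * b), Bialgebra.comul_mul, ← ra.eq, ← rb.eq]
  simp [Finset.sum_mul_sum, Algebra.TensorProduct.tmul_mul_tmul]

/-- The antipode is recovered from a normalized pair of right integrals `Λ ∈ A`, `λ ∈ A*` by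
`s b = λ(Λ₍₁₎ b) Λ₍₂₎`. -/
lemma sum_integral_mul_smul_eq_antipode {ι : Type*} (lam : Module.Dual k A) (Lam : A)
    (hlam : ∀ a : A,
      (TensorProduct.lid k A) (lam.rTensor A (comul (R := k) a)) = lam a • (1 : A))
    (hLam : ∀ a : A, Lam * a = counit (R := k) a • Lam)
    (hpair : lam Lam = 1) (r : Coalgebra.Repr k Lam ι) (b : A) :
    ∑ i ∈ r.index, lam (r.left i * b) • r.right i = antipode k b := by
  let B := ℛ k b
  let L := fun j ↦ ℛ k (B.left j)
  let R := fun j ↦ ℛ k (B.right j)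
  have coassoc (i : ι) :
      ∑ j ∈ B.index, ∑ l ∈ (L j).index,
        lam (r.left i * (L j).left l) • (r.right i * (L j).right l * antipode k (B.right j)) =
      ∑ j ∈ B.index, ∑ l ∈ (R j).index,
        lam (r.left i * B.left j) •
          (r.right i * (R j).left l * antipode k ((R j).right l)) := by
    have h := congr(TensorProduct.lid k A (TensorProduct.map (lam ∘ₗ mulLeft k (r.left i))
      (LinearMap.mul' k A ∘ₗ TensorProduct.map (mulLeft k (r.right i)) (antipode k))
      $(sum_tmul_tmul_eq B L R)))
    simpa using h
  symm
  calc antipode k b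
      = ∑ j ∈ B.index, lam (Lam * B.left j) • (1 : A) * antipode k (B.right j) := by
        conv_lhs => rw [← sum_counit_smul B]
        simp [hLam, hpair]
    _ = ∑ j ∈ B.index, ∑ i ∈ r.index, ∑ l ∈ (L j).index,
          lam (r.left i * (L j).left l) •
            (r.right i * (L j).right l * antipode k (B.right j)) := by
        refine Finset.sum_congr rfl fun j _ ↦ ?_
        rw [← sum_sum_integral_mul_smul_mul lam hlam r (L j)]
        simp [Finset.sum_mul]
    _ = ∑ i ∈ r.index, ∑ j ∈ B.index, ∑ l ∈ (R j).index,
          lam (r.left i * B.left j) •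
            (r.right i * (R j).left l * antipode k ((R j).right l)) := by
        rw [Finset.sum_comm]
        exact Finset.sum_congr rfl fun i _ ↦ coassoc i
    _ = ∑ i ∈ r.index, lam (r.left i * b) • r.right i := by
        refine Finset.sum_congr rfl fun i _ ↦ ?_
        have hb := congr(TensorProduct.rid k A $(sum_tmul_counit_eq (R := k) B))
        simp only [map_sum, TensorProduct.rid_tmul, one_smul] at hb
        conv_rhs => rw [← hb]
        simp only [mul_assoc, ← Finset.smul_sum, ← Finset.mul_sum, sum_mul_antipode_eq_smul]
        simp [Finset.mul_sum, Finset.sum_smul, smul_smul, mul_comm]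

/-- `a₍₁₎ s(a₍₂₎) p(a₍₃₎) = p(a) 1`. -/
lemma sum_mul_antipode_rid_lTensor_comul {ι : Type*} (p : Module.Dual k A) {a : A}
    (r : Coalgebra.Repr k a ι) :
    ∑ i ∈ r.index, r.left i *
      antipode k (TensorProduct.rid k A (p.lTensor A (comul (R := k) (r.right i)))) =
      p a • (1 : A) := by
  let L := fun i ↦ ℛ k (r.left i)
  let R := fun i ↦ ℛ k (r.right i)
  have h := congr(LinearMap.mul' k A (LinearMap.lTensor A (antipode k ∘ₗ
    (TensorProduct.rid k A).toLinearMap ∘ₗ p.lTensor A) $(sum_tmul_tmul_eq r L R)))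
  simp only [map_sum, LinearMap.lTensor_tmul, LinearMap.comp_apply, LinearEquiv.coe_coe,
    TensorProduct.rid_tmul, map_smul, LinearMap.mul'_apply, mul_smul_comm,
    ← Finset.smul_sum, sum_mul_antipode_eq_smul] at h
  have ha := congr(p $(sum_counit_smul (R := k) r))
  simp only [map_sum, map_smul, smul_eq_mul] at ha
  rw [← ha, Finset.sum_smul]
  simp only [smul_smul, mul_comm (p _)] at h
  rw [h]
  refine Finset.sum_congr rfl fun i _ ↦ ?_
  rw [← (R i).eq]
  simp [Finset.mul_sum]

end

/-- Let `P : A → A` be the (unique) linear endomorphism of the finite-dimensional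
Hopf algebra `A` satisfying `p (P a) = tr (s ∘ ℓ(p) ∘ s ∘ r(a))` for all `p ∈ A*`, `a ∈ A`.
If `λ ∈ A*` is a right integral for `A*` (i.e. `λ(a₍₁₎) • a₍₂₎ = λ(a) • 1` for all `a`),
`Λ ∈ A` is a right integral for `A` (i.e. `Λ * a = ε(a) • Λ` for all `a`), and `λ(Λ) = 1`,
then `P a = λ(a) • Λ` for all `a ∈ A`. -/
theorem stmt2 (k A : Type*) [Field k] [Ring A] [HopfAlgebra k A] [FiniteDimensional k A]
    (P : A →ₗ[k] A)
    (hP : ∀ (p : Module.Dual k A) (a : A),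
      p (P a) = LinearMap.trace k A
        (antipode (R := k) ∘ₗ
          ((TensorProduct.rid k A).toLinearMap ∘ₗ p.lTensor A ∘ₗ comul (R := k)) ∘ₗ
          antipode (R := k) ∘ₗ LinearMap.mulRight k a))
    (lam : Module.Dual k A) (Lam : A)
    (hlam : ∀ a : A,
      (TensorProduct.lid k A) (lam.rTensor A (comul (R := k) a)) = lam a • (1 : A))
    (hLam : ∀ a : A, Lam * a = counit (R := k) a • Lam)
    (hpair : lam Lam = 1) :
    ∀ a : A, P a = lam a • Lam := by
  intro a
  rw [← sub_eq_zero, ← Module.forall_dual_apply_eq_zero_iff k]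
  intro p
  rw [map_sub, sub_eq_zero]
  rw [hP]
  let r := ℛ k Lam
  let f : A →ₗ[k] A :=
    (TensorProduct.rid k A).toLinearMap ∘ₗ p.lTensor A ∘ₗ comul (R := k)
  have hf : antipode k ∘ₗ f ∘ₗ antipode k ∘ₗ LinearMap.mulRight k a =
      ∑ i ∈ r.index, (lam ∘ₗ mulLeft k (r.left i) ∘ₗ mulRight k a).smulRight
        (antipode k (f (r.right i))) := by
    ext x
    simp [← sum_integral_mul_smul_eq_antipode lam Lam hlam hLam hpair r (x * a)]
  have hsum := congr(lam ($(sum_mul_antipode_rid_lTensor_comul p r) * a))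
  simp only [Finset.sum_mul, map_sum, smul_mul_assoc, one_mul, map_smul, smul_eq_mul] at hsum
  change LinearMap.trace k A (antipode k ∘ₗ f ∘ₗ antipode k ∘ₗ LinearMap.mulRight k a) = _
  rw [hf, map_sum, map_smul, smul_eq_mul, mul_comm, ← hsum]
  refine Finset.sum_congr rfl fun i _ ↦ ?_
  simp [LinearMap.trace_smulRight, f, mul_assoc]
end

section
/- For all p ∈ A* and a ∈ A, tr(s ∘ ℓ(p) ∘ s ∘ r(a)) = tr(ℓ(s(a)) ∘ s² ∘ ℓ(p)), where ℓ(s(a)) denotes left multiplication by s(a). -/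
open TensorProduct LinearMap HopfAlgebra Coalgebra

/-- The antipode turns right multiplication by `a` into left multiplication by its image. -/
theorem antipode_comp_mulRight {R A : Type*} [CommSemiring R] [Semiring A] [HopfAlgebra R A]
    (a : A) :
    antipode R ∘ₗ LinearMap.mulRight R a = LinearMap.mulLeft R (antipode R a) ∘ₗ antipode R := by
  ext b
  simp [antipode_mul_antidistrib]

/-- For a finite-dimensional Hopf algebra `A` over a field `k` with antipode `s`,
for all `p ∈ A*` and `a ∈ A` one has `tr (s ∘ ℓ(p) ∘ s ∘ r(a)) = tr (ℓ(s a) ∘ s² ∘ ℓ(p))`,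
where `ℓ(p) b = b₍₁₎ p(b₍₂₎)`, `r(a) b = b * a` and `ℓ(s a)` is left multiplication by `s a`. -/
theorem stmt3 (k A : Type*) [Field k] [Ring A] [HopfAlgebra k A] [FiniteDimensional k A]
    (p : Module.Dual k A) (a : A) :
    LinearMap.trace k A
      (antipode (R := k) ∘ₗ
        ((TensorProduct.rid k A).toLinearMap ∘ₗ p.lTensor A ∘ₗ comul (R := k)) ∘ₗ
        antipode (R := k) ∘ₗ LinearMap.mulRight k a) =
    LinearMap.trace k A
      (LinearMap.mulLeft k (antipode (R := k) a) ∘ₗ antipode (R := k) ∘ₗ antipode (R := k) ∘ₗ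
        ((TensorProduct.rid k A).toLinearMap ∘ₗ p.lTensor A ∘ₗ comul (R := k))) := by
  rw [antipode_comp_mulRight]
  generalize (TensorProduct.rid k A).toLinearMap ∘ₗ p.lTensor A ∘ₗ comul (R := k) = f
  calc
    _ = LinearMap.trace k A ((antipode k ∘ₗ f) ∘ₗ
          (LinearMap.mulLeft k (antipode k a) ∘ₗ antipode k)) := rfl
    _ = LinearMap.trace k A
          ((LinearMap.mulLeft k (antipode k a) ∘ₗ antipode k) ∘ₗ (antipode k ∘ₗ f)) :=
      LinearMap.trace_comp_comm' _ _
    _ = _ := rfl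
end

section
/- There exist a right integral λ ∈ A* for A* and a right integral Λ ∈ A for A such that λ(Λ) = 1. In particular, A has a nonzero right integral and A* has a nonzero right integral. -/
open TensorProduct LinearMap HopfAlgebra Coalgebra

namespace HopfAlgebra

section Antipode

variable {k A : Type*} [Field k] [Ring A] [HopfAlgebra k A]

/-- The identity `s(a₍₁₎) a₍₂₎ ⊗ a₍₃₎ = 1 ⊗ a`. -/
lemma sum_antipode_mul_comul {ι : Type*} {a : A} (r : Repr k a ι) :
    ∑ i ∈ r.index, (antipode k (r.left i) ⊗ₜ[k] 1) * comul (r.right i) =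
      (1 : A) ⊗ₜ[k] a := by
  let T : A ⊗[k] A →ₗ[k] A := mul' k A ∘ₗ (antipode k).rTensor A
  have key : T.rTensor A ((TensorProduct.assoc k A A A).symm (comul.lTensor A (comul a))) =
      (1 : A) ⊗ₜ[k] a := by
    rw [coassoc_symm_apply, ← LinearMap.comp_apply, ← LinearMap.rTensor_comp,
      show T ∘ₗ comul = (LinearMap.toSpanSingleton k A 1) ∘ₗ counit from
        LinearMap.ext fun x ↦ by simp [T, Algebra.algebraMap_eq_smul_one],
      LinearMap.rTensor_comp, LinearMap.comp_apply, rTensor_counit_comul]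
    simp
  rw [← key, ← r.eq]
  simp only [map_sum, LinearMap.lTensor_tmul]
  refine Finset.sum_congr rfl fun i _ ↦ ?_
  induction comul (R := k) (r.right i) with
  | zero => simp
  | tmul x y => simp [T]
  | add x y hx hy => simp only [map_add, mul_add, TensorProduct.tmul_add, hx, hy]

/-- The antipode is an anti-homomorphism of coalgebras. -/
lemma comul_antipode_s4 (a : A) :
    comul (R := k) (antipode k a) =
      TensorProduct.map (antipode k) (antipode k) (TensorProduct.comm k A A (comul a)) := by
  suffices h : WithConv.toConv (TensorProduct.map (antipode k) (antipode k) ∘ₗ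
      (TensorProduct.comm k A A).toLinearMap ∘ₗ comul) =
      WithConv.toConv (comul (R := k) (A := A) ∘ₗ antipode k) by
    exact (LinearMap.congr_fun (WithConv.toConv_injective h) a).symm
  refine left_inv_eq_right_inv (a := WithConv.toConv (comul (R := k) (A := A))) ?_
    LinearMap.comul_right_inv
  let J : A →ₗ[k] A ⊗[k] A := TensorProduct.mk k A A 1
  let K : A ⊗[k] A →ₗ[k] A ⊗[k] A :=
    mul' k (A ⊗[k] A) ∘ₗ TensorProduct.map ((TensorProduct.mk k A A).flip 1 ∘ₗ antipode k) comul
  have hK : K ∘ₗ comul = J := LinearMap.ext fun x ↦ by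
    rw [LinearMap.comp_apply, ← (ℛ k x).eq, map_sum]
    simpa [K, J] using sum_antipode_mul_comul (ℛ k x)
  let T : A ⊗[k] (A ⊗[k] A) →ₗ[k] A ⊗[k] A :=
    mul' k (A ⊗[k] A) ∘ₗ TensorProduct.map (J ∘ₗ antipode k) K
  have hT : T ∘ₗ (TensorProduct.assoc k A A A).toLinearMap =
      mul' k (A ⊗[k] A) ∘ₗ TensorProduct.map (TensorProduct.map (antipode k) (antipode k) ∘ₗ
        (TensorProduct.comm k A A).toLinearMap) comul := by
    ext x y z
    simp [T, K, J, ← mul_assoc]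
  ext a
  have key : T ((TensorProduct.assoc k A A A) (comul.rTensor A (comul a))) =
      counit (R := k) a • (1 : A ⊗[k] A) := by
    rw [coassoc_apply]
    have : T ∘ₗ comul.lTensor A = J ∘ₗ mul' k A ∘ₗ (antipode k).rTensor A := by
      ext x y
      simp only [T, TensorProduct.AlgebraTensorModule.curry_apply, TensorProduct.curry_apply,
        LinearMap.restrictScalars_self, LinearMap.comp_apply, LinearMap.lTensor_tmul,
        TensorProduct.map_tmul, LinearMap.rTensor_tmul]
      rw [← LinearMap.comp_apply K, hK]
      simp [J]
    rw [← LinearMap.comp_apply T, this]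
    simp [J, Algebra.algebraMap_eq_smul_one, Algebra.TensorProduct.one_def]
  have h := LinearMap.congr_fun hT (comul.rTensor A (comul (R := k) a))
  simp only [LinearMap.comp_apply, LinearEquiv.coe_coe] at h
  rw [h] at key
  rw [LinearMap.rTensor, ← LinearMap.comp_apply (TensorProduct.map _ _), ← TensorProduct.map_comp]
    at key
  simpa [LinearMap.convMul_def, LinearMap.convOne_def, Algebra.algebraMap_eq_smul_one,
    LinearMap.comp_assoc] using key

variable (k A) in
/-- The square of the antipode, as an algebra endomorphism. -/
noncomputable def antipodeSq : A →ₐ[k] A :=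
  .ofLinearMap (antipode k ∘ₗ antipode k) (by simp) fun x y ↦ by
    simp [antipode_mul_antidistrib]

@[simp] lemma antipodeSq_apply (a : A) : antipodeSq k A a = antipode k (antipode k a) := rfl

lemma comul_antipodeSq (a : A) :
    comul (R := k) (antipodeSq k A a) =
      Algebra.TensorProduct.map (antipodeSq k A) (antipodeSq k A) (comul a) := by
  rw [antipodeSq_apply, comul_antipode_s4, comul_antipode_s4]
  induction comul (R := k) a with
  | zero => simp
  | tmul x y => simp
  | add x y hx hy => simp only [map_add, hx, hy]

/-- The identity `a₍₁₎ ⊗ s(a₍₃₎) s²(a₍₂₎) = a ⊗ 1`. -/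
lemma sum_antipode_mul_map_antipodeSq_comul {ι : Type*} {a : A} (r : Repr k a ι) :
    ∑ i ∈ r.index, (1 ⊗ₜ[k] antipode k (r.right i)) *
      Algebra.TensorProduct.map (AlgHom.id k A) (antipodeSq k A) (comul (r.left i)) =
      a ⊗ₜ[k] (1 : A) := by
  let T : A ⊗[k] A →ₗ[k] A := antipode k ∘ₗ mul' k A ∘ₗ (antipode k).rTensor A
  have hT : ∀ x : A, T (comul x) = counit (R := k) x • 1 := fun x ↦ by
    simp [T, Algebra.algebraMap_eq_smul_one]
  have key : T.lTensor A ((TensorProduct.assoc k A A A) (comul.rTensor A (comul a))) =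
      a ⊗ₜ[k] (1 : A) := by
    rw [coassoc_apply, ← LinearMap.comp_apply, ← LinearMap.lTensor_comp,
      show T ∘ₗ comul = (LinearMap.toSpanSingleton k A 1) ∘ₗ counit from
        LinearMap.ext fun x ↦ by simp [hT],
      LinearMap.lTensor_comp, LinearMap.comp_apply, lTensor_counit_comul]
    simp
  rw [← key, ← r.eq]
  simp only [map_sum, LinearMap.rTensor_tmul]
  refine Finset.sum_congr rfl fun i _ ↦ ?_
  induction comul (R := k) (r.left i) with
  | zero => simp
  | tmul x y => simp [T, antipode_mul_antidistrib]
  | add x y hx hy => simp only [map_add, mul_add, TensorProduct.add_tmul, hx, hy]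

end Antipode

section Integral

variable {k A : Type*} [Field k] [Ring A] [HopfAlgebra k A]

/-- The contraction `x ⊗ y ↦ f x • y`. -/
noncomputable def contractL (f : Module.Dual k A) : A ⊗[k] A →ₗ[k] A :=
  (TensorProduct.lid k A).toLinearMap ∘ₗ f.rTensor A

/-- The contraction `x ⊗ y ↦ f y • x`. -/
noncomputable def contractR {M : Type*} [AddCommGroup M] [Module k M] (f : Module.Dual k M) :
    A ⊗[k] M →ₗ[k] A :=
  (TensorProduct.rid k A).toLinearMap ∘ₗ f.lTensor A

/-- The operator `a ↦ f(a₍₁₎) a₍₂₎`. -/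
noncomputable def hitL (f : Module.Dual k A) : Module.End k A := contractL f ∘ₗ comul

/-- The operator `a ↦ f(a₍₂₎) a₍₁₎`. -/
noncomputable def hitR (f : Module.Dual k A) : Module.End k A := contractR f ∘ₗ comul

@[simp] lemma contractL_tmul (f : Module.Dual k A) (x y : A) :
    contractL f (x ⊗ₜ y) = f x • y := rfl

@[simp] lemma contractR_tmul {M : Type*} [AddCommGroup M] [Module k M] (f : Module.Dual k M)
    (x : A) (y : M) : contractR f (x ⊗ₜ y) = f y • x := rfl

lemma hitL_apply (f : Module.Dual k A) (x : A) : hitL f x = contractL f (comul x) := rfl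

lemma hitR_apply (f : Module.Dual k A) (x : A) : hitR f x = contractR f (comul x) := rfl

lemma contractL_one_tmul_mul (f : Module.Dual k A) (c : A) (w : A ⊗[k] A) :
    contractL f ((1 ⊗ₜ c) * w) = c * contractL f w := by
  induction w with
  | zero => simp
  | tmul x y => simp
  | add x y hx hy => simp only [map_add, mul_add, hx, hy]

lemma contractL_tmul_one_mul (f : Module.Dual k A) (c : A) (w : A ⊗[k] A) :
    contractL f ((c ⊗ₜ 1) * w) = contractL (f ∘ₗ mulLeft k c) w := by
  induction w with
  | zero => simp
  | tmul x y => simp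
  | add x y hx hy => simp only [map_add, mul_add, hx, hy]

lemma contractR_tmul_one_mul (f : Module.Dual k A) (c : A) (w : A ⊗[k] A) :
    contractR f ((c ⊗ₜ 1) * w) = c * contractR f w := by
  induction w with
  | zero => simp
  | tmul x y => simp
  | add x y hx hy => simp only [map_add, mul_add, hx, hy]

lemma contractR_one_tmul_mul (f : Module.Dual k A) (c : A) (w : A ⊗[k] A) :
    contractR f ((1 ⊗ₜ c) * w) = contractR (f ∘ₗ mulLeft k c) w := by
  induction w with
  | zero => simp
  | tmul x y => simp
  | add x y hx hy => simp only [map_add, mul_add, hx, hy]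

lemma hitL_eq_sum (f : Module.Dual k A) {ι : Type*} {a : A} (r : Repr k a ι) :
    hitL f a = ∑ i ∈ r.index, f (r.left i) • r.right i := by
  rw [hitL_apply, ← r.eq, map_sum]; rfl

lemma hitR_eq_sum (f : Module.Dual k A) {ι : Type*} {a : A} (r : Repr k a ι) :
    hitR f a = ∑ i ∈ r.index, f (r.right i) • r.left i := by
  rw [hitR_apply, ← r.eq, map_sum]; rfl

lemma hitL_antipodeSq (f : Module.Dual k A) (a : A) :
    antipodeSq k A (hitL f a) =
      contractL f (Algebra.TensorProduct.map (AlgHom.id k A) (antipodeSq k A) (comul a)) := by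
  rw [hitL_apply]
  induction comul (R := k) a with
  | zero => simp
  | tmul x y => simp
  | add x y hx hy => simp only [map_add, hx, hy]

lemma hitR_comp_hitL (f g : Module.Dual k A) : hitR g ∘ₗ hitL f = hitL f ∘ₗ hitR g := by
  ext a
  have h := congr(contractL f ((contractR g).lTensor A $(coassoc_apply (R := k) a)))
  have hT : ∀ (w : A ⊗[k] A) (z : A), contractL f ((contractR g).lTensor A
      (TensorProduct.assoc k A A A (w ⊗ₜ z))) = g z • contractL f w := fun w z ↦ by
    induction w with
    | zero => simp
    | tmul x y => rw [TensorProduct.assoc_tmul, lTensor_tmul, contractR_tmul, contractL_tmul,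
        contractL_tmul, smul_comm]
    | add x y hx hy => simp only [map_add, TensorProduct.add_tmul, smul_add, hx, hy]
  rw [LinearMap.comp_apply, LinearMap.comp_apply, hitL_eq_sum f (ℛ k a),
    hitR_eq_sum g (ℛ k a)]
  rw [← (ℛ k a).eq] at h
  simp only [map_sum, LinearMap.rTensor_tmul, LinearMap.lTensor_tmul, hT, map_smul] at h ⊢
  exact h.symm

/-- The identity `s²(a₍₁₎)₍₁₎ ⊗ s(a₍₂₎) s²(a₍₁₎)₍₂₎ = s²(a) ⊗ 1`. -/
lemma sum_antipode_mul_comul_antipodeSq {ι : Type*} {a : A} (r : Repr k a ι) :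
    ∑ i ∈ r.index, (1 ⊗ₜ[k] antipode k (r.right i)) * comul (antipodeSq k A (r.left i)) =
      antipodeSq k A a ⊗ₜ[k] (1 : A) := by
  have h := congr(Algebra.TensorProduct.map (antipodeSq k A) (AlgHom.id k A)
    $(sum_antipode_mul_map_antipodeSq_comul r))
  simp only [map_sum, map_mul, Algebra.TensorProduct.map_tmul, map_one, AlgHom.id_apply] at h
  rw [← h]
  refine Finset.sum_congr rfl fun i _ ↦ ?_
  rw [comul_antipodeSq, ← AlgHom.comp_apply, ← Algebra.TensorProduct.map_comp]
  simp

/-- The identity `a₍₁₎ ⊗ s²(a₍₃₎) s(a₍₂₎) = a ⊗ 1`. -/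
lemma lTensor_antipodeSq_mul_antipode (a : A) :
    (mul' k A ∘ₗ TensorProduct.map (antipodeSq k A).toLinearMap (antipode k) ∘ₗ
      (TensorProduct.comm k A A).toLinearMap).lTensor A (comul.lTensor A (comul a)) =
      a ⊗ₜ[k] (1 : A) := by
  have : mul' k A ∘ₗ TensorProduct.map (antipodeSq k A).toLinearMap (antipode k) ∘ₗ
      (TensorProduct.comm k A A).toLinearMap =
      antipode k ∘ₗ mul' k A ∘ₗ (antipode k).lTensor A := by
    ext x y; simp [antipode_mul_antidistrib]
  rw [← LinearMap.comp_apply, ← LinearMap.lTensor_comp, this,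
    show (antipode k ∘ₗ mul' k A ∘ₗ (antipode k).lTensor A) ∘ₗ comul =
        (LinearMap.toSpanSingleton k A 1) ∘ₗ counit from
      LinearMap.ext fun x ↦ by simp [Algebra.algebraMap_eq_smul_one],
    LinearMap.lTensor_comp, LinearMap.comp_apply, lTensor_counit_comul]
  simp

/-- The functional `a ↦ Tr (x ↦ f(x₍₁₎) s²(x₍₂₎) a)`. -/
noncomputable def traceIntegral (f : Module.Dual k A) : Module.Dual k A :=
  trace k A ∘ₗ lcomp k A ((antipodeSq k A).toLinearMap ∘ₗ hitL f) ∘ₗ (LinearMap.mul k A).flip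

lemma traceIntegral_apply (f : Module.Dual k A) (a : A) :
    traceIntegral f a =
      trace k A (mulRight k a ∘ₗ (antipodeSq k A).toLinearMap ∘ₗ hitL f) := rfl

lemma traceIntegral_add (f g : Module.Dual k A) :
    traceIntegral (f + g) = traceIntegral f + traceIntegral g := by
  ext a
  simp only [LinearMap.add_apply, traceIntegral_apply, ← map_add, hitL, contractL, rTensor_add,
    comp_add, add_comp]

lemma traceIntegral_smul (r : k) (f : Module.Dual k A) :
    traceIntegral (r • f) = r • traceIntegral f := by
  ext a
  simp only [LinearMap.smul_apply, traceIntegral_apply, ← map_smul, hitL, contractL, rTensor_smul,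
    comp_smul, smul_comp]

lemma traceIntegral_comp_mulLeft (f : Module.Dual k A) (c a : A) :
    traceIntegral (f ∘ₗ mulLeft k c) a = counit (R := k) c * traceIntegral f a := by
  let r := ℛ k c
  have h : (antipodeSq k A).toLinearMap ∘ₗ hitL (f ∘ₗ mulLeft k c) =
      ∑ i ∈ r.index, mulLeft k (antipode k (r.right i)) ∘ₗ (antipodeSq k A).toLinearMap ∘ₗ
        hitL f ∘ₗ mulLeft k (r.left i) := by
    ext x
    simp only [LinearMap.sum_apply]
    simp only [LinearMap.comp_apply (mulLeft k _),
      LinearMap.comp_apply (antipodeSq k A).toLinearMap, LinearMap.comp_apply (hitL _),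
      AlgHom.toLinearMap_apply, hitL_antipodeSq, mulLeft_apply, Bialgebra.comul_mul, map_mul,
      ← contractL_one_tmul_mul, ← contractL_tmul_one_mul]
    rw [← map_sum]
    simp only [← mul_assoc]
    rw [← Finset.sum_mul, sum_antipode_mul_map_antipodeSq_comul]
  have h₃ : ∀ u v : A, trace k A (mulRight k a ∘ₗ mulLeft k v ∘ₗ (antipodeSq k A).toLinearMap ∘ₗ
        hitL f ∘ₗ mulLeft k u) =
      trace k A (mulLeft k (u * v) ∘ₗ (mulRight k a ∘ₗ (antipodeSq k A).toLinearMap ∘ₗ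
        hitL f)) := fun u v ↦ by
    rw [show mulRight k a ∘ₗ mulLeft k v ∘ₗ (antipodeSq k A).toLinearMap ∘ₗ
        hitL f ∘ₗ mulLeft k u = (mulRight k a ∘ₗ mulLeft k v ∘ₗ (antipodeSq k A).toLinearMap ∘ₗ
        hitL f) * mulLeft k u from rfl, trace_mul_comm]
    congr 1
    ext x
    simp [mul_assoc]
  have hl : ∑ i ∈ r.index, mulLeft k (r.left i * antipode k (r.right i)) =
      counit (R := k) c • (LinearMap.id : A →ₗ[k] A) := by
    ext x
    simp only [LinearMap.sum_apply, mulLeft_apply]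
    rw [← Finset.sum_mul, sum_mul_antipode_eq_smul]
    simp
  rw [traceIntegral_apply, h, ← Module.End.mul_eq_comp, Finset.mul_sum, map_sum]
  simp only [Module.End.mul_eq_comp, h₃]
  rw [← map_sum]
  simp only [← Module.End.mul_eq_comp (mulLeft k _)]
  rw [← Finset.sum_mul, hl, smul_mul_assoc, map_smul]
  rfl

lemma one_tmul_mul_comul_of_left_integral {t : A} (ht : ∀ c : A, c * t = counit (R := k) c • t)
    (c : A) : (1 ⊗ₜ c) * comul (R := k) t = (antipode k c ⊗ₜ 1) * comul (R := k) t := by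
  rw [← sum_antipode_mul_comul (ℛ k c), Finset.sum_mul]
  simp only [mul_assoc, ← Bialgebra.comul_mul, ht, map_smul, mul_smul_comm]
  have h := congr(TensorProduct.rid k A
    ((antipode k).rTensor k $(sum_tmul_counit_eq (R := k) (ℛ k c))))
  simp only [rTensor_tmul, map_sum, TensorProduct.rid_tmul, one_smul] at h
  rw [← h, TensorProduct.sum_tmul, Finset.sum_mul]
  simp only [← TensorProduct.smul_tmul', smul_mul_assoc]

variable [FiniteDimensional k A]

lemma traceIntegral_hitR (f g : Module.Dual k A) (a : A) :
    traceIntegral f (hitR g a) = g 1 * traceIntegral f a := by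
  let b := Module.finBasis k A
  let q := fun j ↦ g ∘ₗ mulLeft k (antipode k (b j))
  have h₁ : mulRight k (hitR g a) ∘ₗ (antipodeSq k A).toLinearMap =
      ∑ j, hitR (q j) ∘ₗ mulRight k a ∘ₗ (antipodeSq k A).toLinearMap ∘ₗ hitR (b.coord j) := by
    ext y
    have hq : ∀ z v : A, ∑ j, b.coord j z • hitR (q j) v =
        contractR g ((1 ⊗ₜ antipode k z) * comul v) := fun z v ↦ by
      conv_rhs => rw [← b.sum_repr z]
      simp only [map_sum, map_smul, TensorProduct.tmul_sum, Finset.sum_mul, TensorProduct.tmul_smul,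
        smul_mul_assoc, contractR_one_tmul_mul]
      rfl
    simp only [LinearMap.sum_apply]
    simp only [LinearMap.comp_apply (hitR _), LinearMap.comp_apply (mulRight k _),
      LinearMap.comp_apply (antipodeSq k A).toLinearMap, hitR_eq_sum (b.coord _) (ℛ k y), map_sum,
      map_smul]
    rw [Finset.sum_comm]
    simp only [hq, mulRight_apply, AlgHom.toLinearMap_apply, Bialgebra.comul_mul, ← mul_assoc]
    rw [← map_sum, ← Finset.sum_mul, sum_antipode_mul_comul_antipodeSq, contractR_tmul_one_mul]
    rfl
  have h₂ : ∑ j, hitR (b.coord j) ∘ₗ hitR (q j) = g 1 • LinearMap.id := by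
    ext x
    let T : Module.Dual k (A ⊗[k] A) := g ∘ₗ mul' k A ∘ₗ (antipode k).rTensor A
    have hT : ∀ (w : A ⊗[k] A) (z : A), contractR T (TensorProduct.assoc k A A A (w ⊗ₜ z)) =
        ∑ j, q j z • contractR (b.coord j) w := fun w z ↦ by
      induction w with
      | zero => simp
      | tmul x y =>
        have hy := congr(g ((antipode k $(b.sum_repr y)) * z))
        simp only [map_sum, map_smul, Finset.sum_mul, smul_mul_assoc, smul_eq_mul] at hy
        simp [T, q, ← hy, Finset.sum_smul, smul_smul, mul_comm]
      | add x y hx hy =>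
        simp only [map_add, TensorProduct.add_tmul, smul_add, Finset.sum_add_distrib, hx, hy]
    have h := congr(contractR T $(coassoc_apply (R := k) x))
    have hr : contractR T (comul.lTensor A (comul x)) = g 1 • x := by
      rw [contractR, LinearMap.comp_apply, ← LinearMap.comp_apply (T.lTensor A), ← LinearMap.lTensor_comp,
        show T ∘ₗ comul = g 1 • counit from LinearMap.ext fun x ↦ by
          simp [T, Algebra.algebraMap_eq_smul_one, mul_comm],
        LinearMap.lTensor_smul, LinearMap.smul_apply, lTensor_counit_comul]
      simp
    rw [hr] at h
    simp only [LinearMap.sum_apply, LinearMap.comp_apply (hitR _), hitR_eq_sum (q _) (ℛ k x),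
      map_sum, map_smul, LinearMap.smul_apply, LinearMap.id_apply]
    rw [← h, Finset.sum_comm]
    conv_rhs => rw [← (ℛ k x).eq]
    simp only [map_sum, LinearMap.rTensor_tmul, hT]
    rfl
  rw [traceIntegral_apply, ← LinearMap.comp_assoc, h₁, ← Module.End.mul_eq_comp, Finset.sum_mul,
    map_sum]
  have h₃ : ∀ j, trace k A ((hitR (q j) ∘ₗ mulRight k a ∘ₗ (antipodeSq k A).toLinearMap ∘ₗ
      hitR (b.coord j)) ∘ₗ hitL f) = trace k A ((mulRight k a ∘ₗ (antipodeSq k A).toLinearMap ∘ₗ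
        hitL f) ∘ₗ (hitR (b.coord j) ∘ₗ hitR (q j))) := fun j ↦ by
    rw [LinearMap.comp_assoc, ← Module.End.mul_eq_comp (hitR (q j)), trace_mul_comm]
    simp only [Module.End.mul_eq_comp, LinearMap.comp_assoc]
    rw [← LinearMap.comp_assoc _ (hitL f) (hitR _), hitR_comp_hitL, LinearMap.comp_assoc]
  simp only [Module.End.mul_eq_comp, h₃]
  simp only [← Module.End.mul_eq_comp] at h₂ ⊢
  rw [← map_sum, ← Finset.mul_sum, h₂, mul_smul_comm, map_smul]
  rfl

/-- `traceIntegral f` is a right integral of the dual. -/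
lemma contractL_traceIntegral (f : Module.Dual k A) (a : A) :
    contractL (traceIntegral f) (comul a) = traceIntegral f a • (1 : A) := by
  rw [← sub_eq_zero, ← Module.forall_dual_apply_eq_zero_iff k]
  intro g
  have := traceIntegral_hitR f g a
  rw [hitR_eq_sum g (ℛ k a)] at this
  rw [← hitL_apply, hitL_eq_sum _ (ℛ k a)]
  simp only [map_sum, map_sub, map_smul, smul_eq_mul] at this ⊢
  rw [mul_comm, ← this, sub_eq_zero]
  exact Finset.sum_congr rfl fun i _ ↦ mul_comm _ _

/-- The functionals `traceIntegral h` and their translates separate points. -/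
lemma exists_traceIntegral_mul_ne_zero {z : A} (hz : z ≠ 0) :
    ∃ (h : Module.Dual k A) (c : A), traceIntegral h (c * z) ≠ 0 := by
  by_contra! H
  refine hz ((Module.forall_dual_apply_eq_zero_iff k z).1 fun f ↦ ?_)
  let b := Module.finBasis k A
  have key : ∑ j, mulRight k (antipode k (b j) * z) ∘ₗ (antipodeSq k A).toLinearMap ∘ₗ
      hitL (f ∘ₗ hitR (b.coord j)) = f.smulRight z := by
    ext x
    let T : A ⊗[k] A →ₗ[k] A := mul' k A ∘ₗ
      TensorProduct.map (antipodeSq k A).toLinearMap (antipode k) ∘ₗ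
      (TensorProduct.comm k A A).toLinearMap
    have hT : ∀ (w : A ⊗[k] A) (y : A),
        contractL f (T.lTensor A (TensorProduct.assoc k A A A (w ⊗ₜ y))) =
          ∑ j, f (contractR (b.coord j) w) • (antipodeSq k A y * antipode k (b j)) := fun w y ↦ by
      induction w with
      | zero => simp
      | tmul u v =>
        have hv := congr(f u • (antipodeSq k A y * antipode k $(b.sum_repr v)))
        simp only [map_sum, map_smul, Finset.mul_sum, Finset.smul_sum, mul_smul_comm] at hv
        simpa [T, smul_smul, mul_comm (f u)] using hv.symm
      | add u v hu hv =>
        simp only [map_add, TensorProduct.add_tmul, add_smul, Finset.sum_add_distrib, hu, hv]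
    have h := congr(contractL f (T.lTensor A $(coassoc_apply (R := k) x)))
    rw [lTensor_antipodeSq_mul_antipode] at h
    have hr : f x • z = contractL f (x ⊗ₜ 1) * z := by simp
    rw [smulRight_apply, hr, ← h]
    conv_rhs => rw [← (ℛ k x).eq]
    simp only [LinearMap.sum_apply]
    simp only [map_sum, LinearMap.rTensor_tmul, hT, LinearMap.comp_apply (mulRight k _),
      LinearMap.comp_apply (antipodeSq k A).toLinearMap, hitL_eq_sum _ (ℛ k x), Finset.sum_mul,
      map_smul, mulRight_apply, AlgHom.toLinearMap_apply, mul_assoc, smul_mul_assoc]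
    rw [Finset.sum_comm]
    rfl
  have := congr(trace k A $key)
  rw [map_sum] at this
  simp only [← traceIntegral_apply, H, Finset.sum_const_zero] at this
  rw [← trace_smulRight f z, ← this]

/-- There is a nonzero left integral in `A`. -/
lemma exists_left_integral : ∃ t : A, t ≠ 0 ∧ ∀ c : A, c * t = counit (R := k) c • t := by
  have : Nontrivial A := Bialgebra.nontrivial (R := k)
  obtain ⟨f, c, hfc⟩ := exists_traceIntegral_mul_ne_zero (k := k) (one_ne_zero (α := A))
  rw [mul_one] at hfc
  let P : Module.Dual k (Module.Dual k A) :=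
    { toFun := fun f ↦ traceIntegral f c
      map_add' := fun f g ↦ by
        rw [← LinearMap.add_apply, traceIntegral_add]
      map_smul' := fun r f ↦ by
        rw [RingHom.id_apply, ← LinearMap.smul_apply, traceIntegral_smul] }
  have hP : ∀ f, f ((Module.evalEquiv k A).symm P) = traceIntegral f c := fun f ↦
    Module.apply_evalEquiv_symm_apply k A f P
  refine ⟨(Module.evalEquiv k A).symm P, fun h ↦ hfc ?_, fun d ↦ ?_⟩
  · rw [← hP, h, map_zero]
  · rw [← sub_eq_zero, ← Module.forall_dual_apply_eq_zero_iff k]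
    intro g
    rw [map_sub, map_smul, hP, ← mulLeft_apply (R := k), ← LinearMap.comp_apply, hP,
      traceIntegral_comp_mulLeft, smul_eq_mul, sub_self]

/-- The antipode of a finite-dimensional Hopf algebra is injective. -/
lemma antipode_injective : Function.Injective (antipode k (A := A)) := by
  rw [injective_iff_map_eq_zero]
  intro c hc
  obtain ⟨t, ht₀, ht⟩ := exists_left_integral (k := k) (A := A)
  obtain ⟨f, d, hfd⟩ := exists_traceIntegral_mul_ne_zero (k := k) ht₀
  rw [ht, map_smul] at hfd
  have h := congr(contractL (traceIntegral f) $(one_tmul_mul_comul_of_left_integral ht c))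
  rw [contractL_one_tmul_mul, contractL_traceIntegral, hc, TensorProduct.zero_tmul, zero_mul,
    map_zero, mul_smul_comm, mul_one] at h
  exact (smul_eq_zero.1 h).resolve_left (right_ne_zero_of_smul hfd)

/-- There is a nonzero right integral in `A`. -/
lemma exists_right_integral : ∃ t : A, t ≠ 0 ∧ ∀ c : A, t * c = counit (R := k) c • t := by
  obtain ⟨t, ht₀, ht⟩ := exists_left_integral (k := k) (A := A)
  refine ⟨antipode k t, (map_ne_zero_iff _ antipode_injective).2 ht₀, fun c ↦ ?_⟩
  obtain ⟨c, rfl⟩ := LinearMap.injective_iff_surjective.1 (antipode_injective (k := k)) c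
  rw [← antipode_mul_antidistrib, ht, map_smul, counit_antipode]

end Integral

end HopfAlgebra

/-- For a finite-dimensional Hopf algebra `A` over a field `k`, there exist a
right integral `λ ∈ A*` for `A*` (i.e. `λ(a₍₁₎) • a₍₂₎ = λ(a) • 1` for all `a`) and a right
integral `Λ ∈ A` for `A` (i.e. `Λ * a = ε(a) • Λ` for all `a`) such that `λ(Λ) = 1`. -/
theorem stmt4 (k A : Type*) [Field k] [Ring A] [HopfAlgebra k A] [FiniteDimensional k A] :
    ∃ (lam : Module.Dual k A) (Lam : A),
      (∀ a : A,
        (TensorProduct.lid k A) (lam.rTensor A (comul (R := k) a)) = lam a • (1 : A)) ∧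
      (∀ a : A, Lam * a = counit (R := k) a • Lam) ∧
      lam Lam = 1 := by
  obtain ⟨t, ht₀, ht⟩ := exists_right_integral (k := k) (A := A)
  obtain ⟨f, c, h⟩ := exists_traceIntegral_mul_ne_zero (k := k) ht₀
  refine ⟨traceIntegral f, (traceIntegral f (c * t))⁻¹ • (c * t), contractL_traceIntegral f,
    fun a ↦ ?_, by rw [map_smul, smul_eq_mul, inv_mul_cancel₀ h]⟩
  rw [smul_mul_assoc, mul_assoc, ht, mul_smul_comm, smul_comm]
end

section
/- The antipode s of a finite-dimensional Hopf algebra A over a field k is bijective. -/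
open HopfAlgebra

section

variable {k A : Type*} [CommSemiring k] [Semiring A] [HopfAlgebra k A]

/-- An algebra homomorphism out of a Hopf algebra is determined by its composite with the antipode,
which is its convolution inverse. -/
lemma algHom_eq_of_forall_antipode {B : Type*} [Semiring B] [Algebra k B] {f g : A →ₐ[k] B}
    (h : ∀ a, f (antipode k a) = g (antipode k a)) : f = g := by
  have hl : WithConv.toConv (f.toLinearMap ∘ₗ LinearMap.id) *
      WithConv.toConv (f.toLinearMap ∘ₗ antipode k) = 1 := by
    apply WithConv.ofConv_injective
    refine (LinearMap.algHom_comp_convMul_distrib f (WithConv.toConv LinearMap.id)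
      (WithConv.toConv (antipode k))).symm.trans ?_
    rw [LinearMap.id_mul_antipode]
    ext
    simp
  have hr : WithConv.toConv (g.toLinearMap ∘ₗ antipode k) *
      WithConv.toConv (g.toLinearMap ∘ₗ LinearMap.id) = 1 := by
    apply WithConv.ofConv_injective
    refine (LinearMap.algHom_comp_convMul_distrib g (WithConv.toConv (antipode k))
      (WithConv.toConv LinearMap.id)).symm.trans ?_
    rw [LinearMap.antipode_mul_id]
    ext
    simp
  rw [← (LinearMap.ext h : f.toLinearMap ∘ₗ antipode k = g.toLinearMap ∘ₗ antipode k)] at hr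
  exact AlgHom.toLinearMap_injective
    (WithConv.toConv_injective (left_inv_eq_right_inv hl hr))

variable (k A) in
/-- The square of the antipode of a Hopf algebra, as an algebra endomorphism. -/
noncomputable def antipodeSqAlgHom : A →ₐ[k] A :=
  .ofLinearMap (antipode k ∘ₗ antipode k) (by simp) (by simp [antipode_mul_antidistrib])

lemma antipodeSqAlgHom_apply (a : A) :
    antipodeSqAlgHom k A a = antipode k (antipode k a) := rfl

lemma antipodeSqAlgHom_pow_antipode (n : ℕ) (a : A) :
    (antipodeSqAlgHom k A ^ n) (antipode k a) = antipode k ((antipodeSqAlgHom k A ^ n) a) := by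
  induction n generalizing a with
  | zero => rfl
  | succ n ih => simp [pow_succ, AlgHom.mul_apply, antipodeSqAlgHom_apply, ih]

/-- An algebra endomorphism that commutes with the antipode and is fixed under composition with
some power of the squared antipode is the identity. -/
lemma eq_id_of_antipodeSqAlgHom_pow_comp_eq {e : A →ₐ[k] A}
    (he : ∀ a, e (antipode k a) = antipode k (e a)) (n : ℕ)
    (h : (antipodeSqAlgHom k A ^ n).comp e = antipodeSqAlgHom k A ^ n) : e = .id k A := by
  induction n with
  | zero => exact h
  | succ n ih =>
    apply ih
    have h_odd : (antipodeAlgHomOp k A).comp ((antipodeSqAlgHom k A ^ n).comp e) =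
        (antipodeAlgHomOp k A).comp (antipodeSqAlgHom k A ^ n) := by
      refine algHom_eq_of_forall_antipode fun a ↦ MulOpposite.unop_injective ?_
      have := DFunLike.congr_fun h a
      simpa [-AlgHom.coe_pow, pow_succ, AlgHom.mul_apply, antipodeSqAlgHom_apply, he,
        antipodeSqAlgHom_pow_antipode] using this
    refine algHom_eq_of_forall_antipode fun a ↦ ?_
    have := congrArg MulOpposite.unop (DFunLike.congr_fun h_odd a)
    simpa [-AlgHom.coe_pow, he, antipodeSqAlgHom_pow_antipode] using this

end

/-- The Fitting projection onto the eventual range of an algebra endomorphism is an algebra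
endomorphism. -/
lemma exists_algHom_fitting_projection {k A : Type*} [Field k] [Ring A] [Algebra k A]
    [FiniteDimensional k A] (f : A →ₐ[k] A) :
    ∃ (n : ℕ) (e : A →ₐ[k] A), (f ^ (n + 1)).comp e = f ^ (n + 1) ∧
      (∀ a, e a ∈ Set.range (f ^ (n + 1))) ∧
      ∀ s : A →ₗ[k] A, (∀ a, (f ^ (n + 1)) (s a) = s ((f ^ (n + 1)) a)) →
        ∀ a, e (s a) = s (e a) := by
  obtain ⟨N, hN⟩ := Filter.eventually_atTop.mp
    (LinearMap.eventually_isCompl_ker_pow_range_pow f.toLinearMap)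
  have hpow : f.toLinearMap ^ (N + 1) = (f ^ (N + 1)).toLinearMap := by
    ext a
    simp [Module.End.pow_apply]
  have hc := (hN (N + 1) (by omega)).symm
  rw [hpow] at hc
  refine ⟨N, ?_⟩
  generalize f ^ (N + 1) = u at hc ⊢
  set p := (LinearMap.range u.toLinearMap).projection (LinearMap.ker u.toLinearMap) hc
  have hmem (a : A) : ∃ b, u b = p a := Submodule.projection_apply_mem hc a
  have hker (a : A) : u (a - p a) = 0 := Submodule.sub_projection_mem hc a
  have huniq {a b : A} (hb : ∃ c, u c = b) (hab : u (a - b) = 0) : p a = b := by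
    have h1 : p b = b := Submodule.projection_apply_of_mem_left hc hb
    have h2 : p (a - b) = 0 := (Submodule.projection_apply_eq_zero_iff hc).mpr hab
    rwa [map_sub, h1, sub_eq_zero] at h2
  have hup (a : A) : u (p a) = u a := by
    have := hker a
    rw [map_sub, sub_eq_zero] at this
    exact this.symm
  refine ⟨.ofLinearMap p (huniq ⟨1, map_one u⟩ (by simp)) fun a b ↦ ?_, ?_, hmem, ?_⟩
  · obtain ⟨c, hca⟩ := hmem a
    obtain ⟨d, hdb⟩ := hmem b
    exact huniq ⟨c * d, by rw [map_mul, hca, hdb]⟩ (by simp [hup])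
  · exact AlgHom.ext hup
  · intro s hs a
    obtain ⟨c, hca⟩ := hmem a
    exact huniq ⟨s c, by rw [hs, hca]; rfl⟩ (by rw [← map_sub, hs]; simp [hup])

/-- The antipode of a finite-dimensional Hopf algebra over a field is bijective. -/
theorem stmt5 (k A : Type*) [Field k] [Ring A] [HopfAlgebra k A] [FiniteDimensional k A] :
    Function.Bijective (antipode (R := k) (A := A)) := by
  obtain ⟨n, e, he, hrange, hcomm⟩ := exists_algHom_fitting_projection (antipodeSqAlgHom k A)
  obtain rfl := eq_id_of_antipodeSqAlgHom_pow_comp_eq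
    (hcomm (antipode k) (antipodeSqAlgHom_pow_antipode (n + 1))) (n + 1) he
  have hsurj : Function.Surjective (antipode (R := k) (A := A)) := fun a ↦ by
    obtain ⟨b, hb⟩ := hrange a
    rw [pow_succ'] at hb
    exact ⟨_, hb⟩
  exact ⟨LinearMap.injective_iff_surjective.mpr hsurj, hsurj⟩
end

section
/- Suppose λ ∈ A* is a right integral for A*, Λ ∈ A is a right integral for A, and λ(Λ) = 1. Then s(a) = λ(Λ₍₁₎·a)·Λ₍₂₎ for all a ∈ A; that is, s(a) = Λ ↼ (a ⇀ λ), where (a ⇀ λ)(b) = λ(ba) and Λ ↼ q = q(Λ₍₁₎)·Λ₍₂₎. -/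
open TensorProduct LinearMap HopfAlgebra Coalgebra

/-- The map `a ↦ lam (x₍₁₎ * a) • x₍₂₎`, that is `a ↦ x ↼ (a ⇀ lam)`. -/
noncomputable def hitMap {k A : Type*} [Field k] [Ring A] [HopfAlgebra k A]
    (lam : Module.Dual k A) (x : A) : A →ₗ[k] A :=
  ∑ i ∈ (ℛ k x).index,
    (lam ∘ₗ LinearMap.mulLeft k ((ℛ k x).left i)).smulRight ((ℛ k x).right i)

theorem hitMap_apply {k A : Type*} [Field k] [Ring A] [HopfAlgebra k A]
    (lam : Module.Dual k A) (x a : A) :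
    hitMap lam x a = (TensorProduct.lid k A)
      ((lam ∘ₗ LinearMap.mulRight k a).rTensor A (comul (R := k) x)) := by
  rw [← (ℛ k x).eq]
  simp [hitMap]

theorem hitMap_convMul_id_apply {k A : Type*} [Field k] [Ring A] [HopfAlgebra k A]
    (lam : Module.Dual k A) (x a : A) :
    (WithConv.toConv (hitMap lam x) * WithConv.toConv LinearMap.id : WithConv (A →ₗ[k] A)) a =
      (TensorProduct.lid k A) (lam.rTensor A (comul (R := k) (x * a))) := by
  rw [(ℛ k a).convMul_apply, Bialgebra.comul_mul, ← (ℛ k x).eq, ← (ℛ k a).eq]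
  simp [hitMap, Finset.sum_mul, Finset.mul_sum]

/-- Let `A` be a finite-dimensional Hopf algebra over a field `k` with antipode
`s`.  Suppose `λ ∈ A*` is a right integral for `A*`, `Λ ∈ A` is a right integral for `A`, and
`λ(Λ) = 1`.  Then `s(a) = λ(Λ₍₁₎ * a) • Λ₍₂₎` for all `a ∈ A`, i.e. `s a = Λ ↼ (a ⇀ λ)`
where `(a ⇀ λ)(b) = λ(b * a)` and `Λ ↼ q = q(Λ₍₁₎) • Λ₍₂₎`. -/
theorem stmt6 (k A : Type*) [Field k] [Ring A] [HopfAlgebra k A] [FiniteDimensional k A]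
    (lam : Module.Dual k A) (Lam : A)
    (hlam : ∀ a : A,
      (TensorProduct.lid k A) (lam.rTensor A (comul (R := k) a)) = lam a • (1 : A))
    (hLam : ∀ a : A, Lam * a = counit (R := k) a • Lam)
    (hpair : lam Lam = 1) :
    ∀ a : A, antipode (R := k) a =
      (TensorProduct.lid k A)
        ((lam ∘ₗ LinearMap.mulRight k a).rTensor A (comul (R := k) Lam)) := by
  have hconv : WithConv.toConv (hitMap lam Lam) * WithConv.toConv LinearMap.id =
      (1 : WithConv (A →ₗ[k] A)) := by
    ext a
    rw [hitMap_convMul_id_apply, hLam, hlam]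
    simp [hpair, Algebra.algebraMap_eq_smul_one]
  intro a
  rw [← hitMap_apply, WithConv.toConv_injective
    (left_inv_eq_right_inv hconv LinearMap.id_mul_antipode)]
end

section
/- Suppose λ ∈ A* is a right integral for A*, Λ ∈ A is a right integral for A, and λ(Λ) = 1. Define f : A → A* by f(a)(b) = λ(s(a)·b). Then f is a linear isomorphism of A onto A* which satisfies f(ab) = f(b) ↼ s(a) and f(a ↼ p) = f(a)·p for all a, b ∈ A and p ∈ A*, where (q ↼ c)(b) = q(cb), a ↼ p = p(a₍₁₎)·a₍₂₎, and the product on A* is the convolution product (qp)(c) = q(c₍₁₎)p(c₍₂₎). -/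
open TensorProduct LinearMap HopfAlgebra Coalgebra
open WithConv

namespace HopfAlgebra

section Semiring

variable {R A ι : Type*} [CommSemiring R] [Semiring A] [HopfAlgebra R A]

lemma toConv_includeLeft_antipode_mul_comul :
    toConv ((Algebra.TensorProduct.includeLeft (R := R) (S := R) (A := A) (B := A)).toLinearMap ∘ₗ
        antipode R) * toConv (comul (R := R) (A := A)) =
      toConv (Algebra.TensorProduct.includeRight (R := R) (A := A) (B := A)).toLinearMap := by
  have hcomul : toConv (comul (R := R) (A := A)) =
      toConv (Algebra.TensorProduct.includeLeft (R := R) (S := R) (A := A) (B := A)).toLinearMap *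
      toConv (Algebra.TensorProduct.includeRight (R := R) (A := A) (B := A)).toLinearMap := by
    ext a
    rw [(ℛ R a).convMul_apply]
    simp [(ℛ R a).eq]
  rw [hcomul, ← mul_assoc]
  convert one_mul _
  ext a
  rw [(ℛ R a).convMul_apply]
  simp [← TensorProduct.sum_tmul, sum_antipode_mul_eq_algebraMap_counit (ℛ R a),
    Algebra.TensorProduct.algebraMap_apply]

/-- In Sweedler notation, `(1 ⊗ a₍₁₎) * Δ(s(a₍₂₎)) = s(a) ⊗ 1`. -/
lemma sum_one_tmul_mul_comul_antipode {a : A} (repr : Repr R a ι) :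
    ∑ i ∈ repr.index, (1 ⊗ₜ[R] repr.left i) * comul (R := R) (antipode R (repr.right i)) =
      antipode R a ⊗ₜ[R] 1 := by
  have h : toConv (Algebra.TensorProduct.includeRight (R := R) (A := A) (B := A)).toLinearMap *
      toConv (comul (R := R) ∘ₗ antipode R (A := A)) =
      toConv ((Algebra.TensorProduct.includeLeft (R := R) (S := R) (A := A) (B := A)).toLinearMap
        ∘ₗ antipode R) := by
    rw [← toConv_includeLeft_antipode_mul_comul, mul_assoc, comul_right_inv, mul_one]
  simpa [repr.convMul_apply] using congr($h a)

variable {lam : Module.Dual R A}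
  (hlam : ∀ a : A,
    (TensorProduct.lid R A) (lam.rTensor A (comul (R := R) a)) = lam a • (1 : A))

include hlam

/-- In Sweedler notation, `λ(s(a₍₂₎) * c) a₍₁₎ = λ(s(a) * c₍₁₎) c₍₂₎` for a right integral `λ`. -/
lemma sum_integral_antipode_mul_smul {a : A} (repr : Repr R a ι) (c : A) :
    ∑ i ∈ repr.index, lam (antipode R (repr.right i) * c) • repr.left i =
      TensorProduct.lid R A (lam.rTensor A ((antipode R a ⊗ₜ[R] 1) * comul (R := R) c)) := by
  have hmul (x : A) (y : A ⊗[R] A) :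
      TensorProduct.lid R A (lam.rTensor A ((1 ⊗ₜ[R] x) * y)) =
        x * TensorProduct.lid R A (lam.rTensor A y) := by
    induction y with
    | zero => simp
    | add y z hy hz => simp [mul_add, hy, hz]
    | tmul y z => simp
  rw [← sum_one_tmul_mul_comul_antipode repr, Finset.sum_mul]
  simp only [map_sum, mul_assoc, hmul, ← Bialgebra.comul_mul, hlam, mul_smul_comm, mul_one]

lemma integral_antipode_transpose_mul (a : A) (p : Module.Dual R A) (c : A) :
    lam (antipode R (TensorProduct.lid R A (p.rTensor A (comul (R := R) a))) * c) =
      LinearMap.mul' R R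
        (TensorProduct.map (lam ∘ₗ LinearMap.mulLeft R (antipode R a)) p (comul (R := R) c)) := by
  have h := congr(p $(sum_integral_antipode_mul_smul hlam (ℛ R a) c))
  rw [← (ℛ R a).eq]
  rw [← (ℛ R c).eq] at h ⊢
  simp only [map_sum, Finset.mul_sum, Finset.sum_mul, map_smul, rTensor_tmul, smul_mul_assoc,
    TensorProduct.lid_tmul, smul_eq_mul, Algebra.TensorProduct.tmul_mul_tmul, one_mul,
    TensorProduct.map_tmul, LinearMap.mul'_apply, LinearMap.comp_apply,
    LinearMap.mulLeft_apply] at h ⊢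
  rw [← h]
  exact Finset.sum_congr rfl fun _ _ ↦ mul_comm _ _

end Semiring

section Field

variable {k A : Type*} [Field k] [Ring A] [HopfAlgebra k A]

/-- A left ideal of a Hopf algebra that is stable under the coaction `a ↦ p(a₍₁₎) a₍₂₎`
and does not contain `1` is trivial. -/
lemma eq_bot_of_transpose_mem (K : Submodule k A) (hmul : ∀ a, ∀ b ∈ K, a * b ∈ K)
    (hcomul : ∀ a ∈ K, ∀ p : Module.Dual k A,
      TensorProduct.lid k A (p.rTensor A (comul (R := k) a)) ∈ K)
    (hone : (1 : A) ∉ K) : K = ⊥ := by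
  have hcounit : ∀ a ∈ K, counit (R := k) a = 0 := by
    intro a ha
    obtain ⟨⟨ι, b⟩⟩ := Module.Free.exists_basis k A
    classical
    let c := TensorProduct.equivFinsuppOfBasisLeft b (comul (R := k) a)
    have hc : c.sum (fun i n ↦ b i ⊗ₜ n) = comul (R := k) a := by
      rw [← TensorProduct.equivFinsuppOfBasisLeft_symm_apply, LinearEquiv.symm_apply_apply]
    have hmem (i) : c i ∈ K := by
      rw [TensorProduct.equivFinsuppOfBasisLeft_apply]
      exact hcomul a ha (b.coord i)
    by_contra h
    refine hone ?_
    have hsum : algebraMap k A (counit (R := k) a) ∈ K := by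
      rw [← mul_antipode_rTensor_comul_apply, ← hc]
      simp only [Finsupp.sum, map_sum, rTensor_tmul, LinearMap.mul'_apply]
      exact K.sum_mem fun i _ ↦ hmul _ _ (hmem i)
    rw [Algebra.algebraMap_eq_smul_one] at hsum
    exact (K.smul_mem_iff h).mp hsum
  rw [Submodule.eq_bot_iff]
  intro a ha
  rw [← Module.forall_dual_apply_eq_zero_iff k]
  intro p
  have h := hcounit _ (hcomul a ha p)
  rw [← (ℛ k a).eq] at h
  have h' := congr(p $(sum_tmul_counit_eq (ℛ k a) |> congrArg (TensorProduct.rid k A)))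
  simp only [map_sum, rTensor_tmul, TensorProduct.lid_tmul, TensorProduct.rid_tmul, map_smul,
    smul_eq_mul, one_mul] at h h'
  rw [← h', ← h]
  exact Finset.sum_congr rfl fun _ _ ↦ mul_comm _ _

end Field

end HopfAlgebra

/-- Let `A` be a finite-dimensional Hopf algebra over a field `k` with antipode
`s`.  Suppose `λ ∈ A*` is a right integral for `A*`, `Λ ∈ A` is a right integral for `A`, and
`λ(Λ) = 1`.  Define `f : A → A*` by `f(a)(b) = λ(s(a) * b)`.  Then `f` is a linear
isomorphism of `A` onto `A*` satisfying `f(a*b) = f(b) ↼ s(a)` and `f(a ↼ p) = f(a)·p` for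
all `a, b ∈ A`, `p ∈ A*`, where `(q ↼ c)(b) = q(c*b)`, `a ↼ p = p(a₍₁₎) • a₍₂₎`, and the
(convolution) product on `A*` is `(q·p)(c) = q(c₍₁₎) p(c₍₂₎)`. -/
theorem stmt7 (k A : Type*) [Field k] [Ring A] [HopfAlgebra k A] [FiniteDimensional k A]
    (lam : Module.Dual k A) (Lam : A)
    (hlam : ∀ a : A,
      (TensorProduct.lid k A) (lam.rTensor A (comul (R := k) a)) = lam a • (1 : A))
    (hLam : ∀ a : A, Lam * a = counit (R := k) a • Lam)
    (hpair : lam Lam = 1) :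
    ∃ F : A ≃ₗ[k] Module.Dual k A,
      (∀ a b : A, F a b = lam (antipode (R := k) a * b)) ∧
      (∀ a b c : A, F (a * b) c = F b (antipode (R := k) a * c)) ∧
      (∀ (a : A) (p : Module.Dual k A) (c : A),
        F ((TensorProduct.lid k A) (p.rTensor A (comul (R := k) a))) c =
          (LinearMap.mul' k k) ((TensorProduct.map (F a) p) (comul (R := k) c))) := by
  let f : A →ₗ[k] Module.Dual k A :=
    (LinearMap.mul k A).compr₂ lam ∘ₗ antipode k
  have hf (a b : A) : f a b = lam (antipode k a * b) := rfl
  have hmul (a b c : A) : f (a * b) c = f b (antipode k a * c) := by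
    rw [hf, hf, antipode_mul_antidistrib, mul_assoc]
  have htranspose (a : A) (p : Module.Dual k A) (c : A) :
      f ((TensorProduct.lid k A) (p.rTensor A (comul (R := k) a))) c =
        (LinearMap.mul' k k) ((TensorProduct.map (f a) p) (comul (R := k) c)) :=
    integral_antipode_transpose_mul hlam a p c
  have hker : LinearMap.ker f = ⊥ := by
    refine eq_bot_of_transpose_mem _ (fun a b hb ↦ ?_) (fun a ha p ↦ ?_) fun h ↦ ?_
    · ext c
      rw [hmul, LinearMap.mem_ker.mp hb]
      simp
    · ext c
      rw [htranspose, LinearMap.mem_ker.mp ha]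
      simp
    · have := congr($(LinearMap.mem_ker.mp h) Lam)
      simp [hf, hpair] at this
  exact ⟨f.linearEquivOfInjective (LinearMap.ker_eq_bot.mp hker) Subspace.dual_finrank_eq.symm,
    hf, hmul, htranspose⟩
end

section
/- Suppose 𝒫 is a nonzero integral and cointegral for A and write 𝒫 = Σᵢ₌₁ʳ λᵢ ⊗ Λᵢ as an endomorphism of A (i.e. 𝒫(a) = Σᵢ λᵢ(a)·Λᵢ) with λ₁,…,λᵣ ∈ A* and Λ₁,…,Λᵣ ∈ A and with r as small as possible (equivalently, with both families {λ₁,…,λᵣ} and {Λ₁,…,Λᵣ} linearly independent). Then each λᵢ is a right integral for A* and each Λᵢ is a right integral for A. -/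
open TensorProduct LinearMap HopfAlgebra Coalgebra

/-- The members of a linearly independent family over a field are separated by functionals. -/
theorem LinearIndependent.exists_dual_apply_eq_single {k V ι : Type*} [Field k] [AddCommGroup V]
    [Module k V] [DecidableEq ι] {v : ι → V} (hv : LinearIndependent k v) (i : ι) :
    ∃ f : Module.Dual k V, ∀ j, f (v j) = Pi.single (M := fun _ => k) j 1 i := by
  obtain ⟨g, hg⟩ := LinearMap.exists_leftInverse_of_injective
    (Finsupp.linearCombination k v) (LinearMap.ker_eq_bot.mpr hv)
  refine ⟨Finsupp.lapply i ∘ₗ g, fun j => ?_⟩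
  have h := LinearMap.congr_fun hg (Finsupp.single j 1)
  simp only [LinearMap.comp_apply, Finsupp.linearCombination_single, one_smul,
    LinearMap.id_apply] at h
  simp [h, Finsupp.single_apply, Pi.single_apply, eq_comm]

/-- If the functionals `f i` are linearly independent, then `∑ i, f i ⊗ w i`, viewed as a linear
map, vanishes only if all `w i` do. -/
theorem LinearIndependent.eq_zero_of_sum_apply_smul_eq_zero {k V W ι : Type*} [Field k]
    [AddCommGroup V] [Module k V] [AddCommGroup W] [Module k W] [Fintype ι]
    {f : ι → Module.Dual k V} (hf : LinearIndependent k f) {w : ι → W}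
    (h : ∀ a, ∑ i, f i a • w i = 0) (i : ι) : w i = 0 := by
  rw [← Module.forall_dual_apply_eq_zero_iff k]
  intro g
  refine Fintype.linearIndependent_iff.mp hf (fun j => g (w j)) ?_ i
  ext a
  simpa [mul_comm] using congrArg g (h a)

/-- Let `A` be a finite-dimensional Hopf algebra over a field `k`.  Suppose `𝒫`
is a nonzero integral and cointegral for `A` (i.e. `𝒫(a₍₁₎) ⊗ a₍₂₎ = 𝒫 a ⊗ 1` and
`𝒫 a * b = ε(b) • 𝒫 a`), written `𝒫 a = ∑ i, λᵢ(a) • Λᵢ` with both families `(λᵢ)` in `A*`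
and `(Λᵢ)` in `A` linearly independent (`r` as small as possible).  Then each `λᵢ` is a right
integral for `A*` and each `Λᵢ` is a right integral for `A`. -/
theorem stmt8 (k A : Type*) [Field k] [Ring A] [HopfAlgebra k A] [FiniteDimensional k A]
    (P : A →ₗ[k] A)
    (hP1 : ∀ a : A, P.rTensor A (comul (R := k) a) = P a ⊗ₜ[k] (1 : A))
    (hP2 : ∀ a b : A, P a * b = counit (R := k) b • P a)
    (hP0 : P ≠ 0)
    (r : ℕ) (lam : Fin r → Module.Dual k A) (Lam : Fin r → A)
    (hlamind : LinearIndependent k lam) (hLamind : LinearIndependent k Lam)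
    (hrep : ∀ a : A, P a = ∑ i, lam i a • Lam i) :
    (∀ i, ∀ a : A,
      (TensorProduct.lid k A) ((lam i).rTensor A (comul (R := k) a)) = lam i a • (1 : A)) ∧
    (∀ i, ∀ a : A, Lam i * a = counit (R := k) a • Lam i) := by
  refine ⟨fun i a => ?_, fun i b => ?_⟩
  · obtain ⟨f, hf⟩ := hLamind.exists_dual_apply_eq_single i
    have hlam : lam i = f ∘ₗ P := by
      ext a
      simp [hrep, hf, Pi.single_apply]
    rw [hlam, LinearMap.rTensor_comp, LinearMap.comp_apply, hP1]
    simp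
  · rw [← sub_eq_zero]
    refine hlamind.eq_zero_of_sum_apply_smul_eq_zero
      (w := fun i => Lam i * b - counit (R := k) b • Lam i) (fun a => ?_) i
    have h := hP2 a b
    rw [hrep, Finset.sum_mul, Finset.smul_sum] at h
    simp only [smul_sub, Finset.sum_sub_distrib, sub_eq_zero]
    simpa only [smul_mul_assoc, smul_comm (counit (R := k) b)] using h
end

section
/- Let λ ∈ A* be a right integral for A*. Then λ(a·b₍₁₎)·b₍₂₎ = λ(a₍₁₎·b)·s⁻¹(a₍₂₎) for all a, b ∈ A, where s⁻¹ is the inverse of the (bijective) antipode s. -/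
open TensorProduct LinearMap HopfAlgebra Coalgebra

section

variable {k A : Type*} [Field k] [Ring A] [HopfAlgebra k A]

/-- The linear map `y ⊗ z ↦ f z * y`. -/
noncomputable def twistedMul (f : A →ₗ[k] A) : A ⊗[k] A →ₗ[k] A :=
  LinearMap.mul' k A ∘ₗ (TensorProduct.comm k A A).toLinearMap ∘ₗ f.lTensor A

lemma twistedMul_tmul (f : A →ₗ[k] A) (y z : A) : twistedMul f (y ⊗ₜ[k] z) = f z * y := by
  simp [twistedMul]

/-- The inverse of the antipode satisfies `s⁻¹(x₍₂₎) x₍₁₎ = ε(x) 1`. -/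
lemma twistedMul_antipode_inv_comul (f : A →ₗ[k] A)
    (hf1 : f ∘ₗ antipode (R := k) = LinearMap.id)
    (hf2 : antipode (R := k) ∘ₗ f = LinearMap.id) (x : A) :
    twistedMul f (comul (R := k) x) = counit (R := k) x • (1 : A) := by
  have key : antipode k ∘ₗ twistedMul f =
      LinearMap.mul' k A ∘ₗ (antipode k).rTensor A := by
    ext y z
    have hz : antipode k (f z) = z := LinearMap.congr_fun hf2 z
    simp [twistedMul_tmul, antipode_mul_antidistrib, hz]
  have h1 : antipode k (twistedMul f (comul (R := k) x)) = counit (R := k) x • (1 : A) := by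
    have := LinearMap.congr_fun key (comul (R := k) x)
    simpa [Algebra.algebraMap_eq_smul_one] using this
  have h2 : ∀ y, f (antipode k y) = y := LinearMap.congr_fun hf1
  have h3 : f 1 = 1 := by simpa using h2 1
  rw [← h2 (twistedMul f (comul (R := k) x)), h1, map_smul, h3]

/-- The linear map `x ⊗ (y ⊗ z) ↦ lam (x * c) • (f z * y * d)`. -/
noncomputable def pairMul (f : A →ₗ[k] A) (lam : Module.Dual k A) (c d : A) :
    A ⊗[k] (A ⊗[k] A) →ₗ[k] A :=
  (TensorProduct.lid k A).toLinearMap ∘ₗ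
    TensorProduct.map (lam ∘ₗ LinearMap.mulRight k c) (LinearMap.mulRight k d ∘ₗ twistedMul f)

lemma pairMul_tmul (f : A →ₗ[k] A) (lam : Module.Dual k A) (c d x : A) (t : A ⊗[k] A) :
    pairMul f lam c d (x ⊗ₜ[k] t) = lam (x * c) • (twistedMul f t * d) := by
  simp [pairMul]

lemma sum_pairMul_assoc_tmul (f : A →ₗ[k] A) (lam : Module.Dual k A) {ι : Type*} [Fintype ι]
    (c d : ι → A) (t : A ⊗[k] A) (z : A) :
    ∑ i, pairMul f lam (c i) (d i) (TensorProduct.assoc k A A A (t ⊗ₜ[k] z)) =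
      f z * TensorProduct.lid k A (lam.rTensor A (t * ∑ i, c i ⊗ₜ[k] d i)) := by
  induction t with
  | zero => simp
  | tmul x y =>
    simp [pairMul_tmul, twistedMul_tmul, Finset.mul_sum, mul_assoc]
  | add s t hs ht =>
    simp only [TensorProduct.add_tmul, map_add, Finset.sum_add_distrib, hs, ht, add_mul, mul_add]

end

/-- Let `A` be a finite-dimensional Hopf algebra over a field `k` with
(bijective) antipode `s`, and let `sInv` be the inverse of `s`.  If `λ ∈ A*` is a right
integral for `A*` (i.e. `λ(a₍₁₎) • a₍₂₎ = λ(a) • 1` for all `a`), then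
`λ(a·b₍₁₎) • b₍₂₎ = λ(a₍₁₎·b) • s⁻¹(a₍₂₎)` for all `a, b ∈ A` (stated via arbitrary finite
representations `Δ a = ∑ⱼ a1ⱼ ⊗ a2ⱼ` and `Δ b = ∑ᵢ b1ᵢ ⊗ b2ᵢ` of the coproducts). -/
theorem stmt12 (k A : Type*) [Field k] [Ring A] [HopfAlgebra k A] [FiniteDimensional k A]
    (sInv : A →ₗ[k] A)
    (hs1 : sInv ∘ₗ antipode (R := k) = LinearMap.id)
    (hs2 : antipode (R := k) ∘ₗ sInv = LinearMap.id)
    (lam : Module.Dual k A)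
    (hlam : ∀ a : A,
      (TensorProduct.lid k A) (lam.rTensor A (comul (R := k) a)) = lam a • (1 : A))
    (a b : A)
    (ι : Type) [Fintype ι] (b1 b2 : ι → A)
    (hb : comul (R := k) b = ∑ i, b1 i ⊗ₜ[k] b2 i)
    (κ : Type) [Fintype κ] (a1 a2 : κ → A)
    (ha : comul (R := k) a = ∑ j, a1 j ⊗ₜ[k] a2 j) :
    ∑ i, lam (a * b1 i) • b2 i = ∑ j, lam (a1 j * b) • sInv (a2 j) := by
  have hR := congrArg (fun t => ∑ i, pairMul sInv lam (b1 i) (b2 i) t)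
    (Coalgebra.coassoc_apply (R := k) a)
  simp only [ha, map_sum, LinearMap.rTensor_tmul, LinearMap.lTensor_tmul] at hR
  have hl : ∑ i, ∑ j, pairMul sInv lam (b1 i) (b2 i)
      (TensorProduct.assoc k A A A (comul (R := k) (a1 j) ⊗ₜ[k] a2 j)) =
      ∑ j, lam (a1 j * b) • sInv (a2 j) := by
    rw [Finset.sum_comm]
    refine Finset.sum_congr rfl fun j _ => ?_
    rw [sum_pairMul_assoc_tmul, ← hb, ← Bialgebra.comul_mul, hlam]
    simp
  have hcounit : ∑ j, counit (R := k) (a2 j) • a1 j = a := by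
    have := congrArg (TensorProduct.rid k A) (Coalgebra.lTensor_counit_comul (R := k) a)
    simpa [ha] using this
  rw [hl] at hR
  rw [hR]
  refine Finset.sum_congr rfl fun i _ => ?_
  simp only [pairMul_tmul, twistedMul_antipode_inv_comul sInv hs1 hs2]
  conv_lhs => rw [← hcounit]
  simp [Finset.sum_mul, Finset.sum_smul, smul_smul, mul_comm]
end

section
/- For all a ∈ A and p ∈ A* the following equality of endomorphisms of A holds: r(a) ∘ ℓ(p) = ℓ(s(a₍₂₎) ⇀ p) ∘ r(a₍₁₎) (with an implicit Sweedler sum over a₍₁₎ ⊗ a₍₂₎); equivalently, (b₍₁₎ p(b₍₂₎))·a = (b·a₍₁₎)₍₁₎ · p((b·a₍₁₎)₍₂₎ · s(a₍₂₎)) for all b ∈ A. Moreover r(a) ∘ ℓ(p) equals the convolution product 1_A ⋆ (p ⊗ a) in the convolution algebra End(A). -/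
open TensorProduct LinearMap HopfAlgebra Coalgebra

/-- Multiplying the right tensor factor by `s(a₍₂₎)` undoes the comultiplication:
`Δ(a₍₁₎) · (1 ⊗ s(a₍₂₎)) = a ⊗ 1`. -/
lemma sum_comul_mul_one_tmul_antipode_s13 {R A κ : Type*} [CommSemiring R] [Semiring A]
    [HopfAlgebra R A] [Fintype κ] {a : A} {a1 a2 : κ → A}
    (ha : comul (R := R) a = ∑ j, a1 j ⊗ₜ[R] a2 j) :
    ∑ j, comul (R := R) (a1 j) * (1 ⊗ₜ[R] antipode R (a2 j)) = a ⊗ₜ[R] 1 := by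
  have key (x y : A) : comul (R := R) x * (1 ⊗ₜ[R] antipode R y) =
      (mul' R A ∘ₗ (antipode R).lTensor A).lTensor A
        (TensorProduct.assoc R A A A (comul (R := R) x ⊗ₜ y)) := by
    induction comul (R := R) x with
    | zero => simp
    | tmul u v => simp
    | add u v hu hv => simp [add_mul, TensorProduct.add_tmul, hu, hv]
  calc
    _ = (mul' R A ∘ₗ (antipode R).lTensor A).lTensor A
          (TensorProduct.assoc R A A A (comul.rTensor A (comul (R := R) a))) := by
      simp only [key, ha, map_sum, rTensor_tmul]
    _ = (Algebra.linearMap R A).lTensor A (counit.lTensor A (comul (R := R) a)) := by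
      rw [coassoc_apply, ← lTensor_comp_apply, comp_assoc, mul_antipode_lTensor_comul,
        lTensor_comp_apply]
    _ = a ⊗ₜ[R] 1 := by simp

/-- Let `A` be a finite-dimensional Hopf algebra over a field `k` with antipode
`s`.  For `a ∈ A` and `p ∈ A*`, writing `Δ a = ∑ⱼ a1ⱼ ⊗ a2ⱼ`, one has
`r(a) ∘ ℓ(p) = ∑ⱼ ℓ(s(a2ⱼ) ⇀ p) ∘ r(a1ⱼ)` (where `ℓ(q) b = b₍₁₎ q(b₍₂₎)`, `r(c) b = b·c`,
and `(c ⇀ p)(b) = p(b·c)`), and moreover `r(a) ∘ ℓ(p)` equals the convolution product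
`1_A ⋆ (p ⊗ a)` in `End(A)`, where `p ⊗ a` is the endomorphism `b ↦ p(b) • a` and
`(f ⋆ g)(b) = f(b₍₁₎)·g(b₍₂₎)`. -/
theorem stmt13 (k A : Type*) [Field k] [Ring A] [HopfAlgebra k A] [FiniteDimensional k A]
    (a : A) (p : Module.Dual k A)
    (κ : Type) [Fintype κ] (a1 a2 : κ → A)
    (ha : comul (R := k) a = ∑ j, a1 j ⊗ₜ[k] a2 j) :
    (LinearMap.mulRight k a ∘ₗ
        ((TensorProduct.rid k A).toLinearMap ∘ₗ p.lTensor A ∘ₗ comul (R := k)) =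
      ∑ j, ((TensorProduct.rid k A).toLinearMap ∘ₗ
          (p ∘ₗ LinearMap.mulRight k (antipode (R := k) (a2 j))).lTensor A ∘ₗ
            comul (R := k)) ∘ₗ LinearMap.mulRight k (a1 j)) ∧
    (LinearMap.mulRight k a ∘ₗ
        ((TensorProduct.rid k A).toLinearMap ∘ₗ p.lTensor A ∘ₗ comul (R := k)) =
      LinearMap.mul' k A ∘ₗ
        (TensorProduct.map LinearMap.id (p.smulRight a)) ∘ₗ comul (R := k)) := by
  refine ⟨LinearMap.ext fun b ↦ ?_, LinearMap.ext fun b ↦ ?_⟩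
  · have mul_right (t : A ⊗[k] A) (c : A) :
        (p ∘ₗ mulRight k c).lTensor A t = p.lTensor A (t * (1 ⊗ₜ[k] c)) := by
      induction t with
      | zero => simp
      | tmul u v => simp
      | add u v hu hv => simp [add_mul, hu, hv]
    have mul_left (t : A ⊗[k] A) : TensorProduct.rid k A (p.lTensor A t) * a =
        TensorProduct.rid k A (p.lTensor A (t * (a ⊗ₜ[k] 1))) := by
      induction t with
      | zero => simp
      | tmul u v => simp
      | add u v hu hv => simp [add_mul, hu, hv]
    simp only [comp_apply, LinearMap.sum_apply, mulRight_apply, LinearEquiv.coe_coe, mul_right,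
      mul_left, Bialgebra.comul_mul, mul_assoc]
    rw [← sum_comul_mul_one_tmul_antipode_s13 ha, Finset.mul_sum, map_sum, map_sum]
  · simp only [comp_apply, mulRight_apply, LinearEquiv.coe_coe]
    induction comul (R := k) b with
    | zero => simp
    | tmul u v => simp
    | add u v hu hv => simp [add_mul, hu, hv]
end

section
/- Let ℰ : End(A) → End(A) be the linear map defined by q(ℰ(f)(a)) = tr(ℓ(a) ∘ f ∘ r(q)) for all q ∈ A*, f ∈ End(A), a ∈ A. Then for all p ∈ A* and a ∈ A, ℰ(p ⊗ a) = ℓ(p) ∘ r(a), where p ⊗ a denotes the endomorphism b ↦ p(b)·a. -/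
open TensorProduct LinearMap HopfAlgebra Coalgebra

/-- Let `A` be a finite-dimensional Hopf algebra over a field `k` and let
`ℰ : End(A) → End(A)` be the linear map defined by `q(ℰ(f)(a)) = tr(ℓ(a) ∘ f ∘ r(q))` for
all `q ∈ A*`, `f ∈ End(A)`, `a ∈ A`, where `ℓ(a) b = a·b` and `r(q) b = q(b₍₁₎) • b₍₂₎`.
Then for all `p ∈ A*` and `a ∈ A`, `ℰ(p ⊗ a) = ℓ(p) ∘ r(a)`, where `p ⊗ a` is the
endomorphism `b ↦ p(b) • a`, `ℓ(p) b = b₍₁₎ p(b₍₂₎)` and `r(a) b = b·a`. -/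
theorem stmt14 (k A : Type*) [Field k] [Ring A] [HopfAlgebra k A] [FiniteDimensional k A]
    (E : (A →ₗ[k] A) →ₗ[k] (A →ₗ[k] A))
    (hE : ∀ (q : Module.Dual k A) (f : A →ₗ[k] A) (a : A),
      q (E f a) = LinearMap.trace k A
        (LinearMap.mulLeft k a ∘ₗ f ∘ₗ
          ((TensorProduct.lid k A).toLinearMap ∘ₗ q.rTensor A ∘ₗ comul (R := k)))) :
    ∀ (p : Module.Dual k A) (a : A),
      E (p.smulRight a) =
        ((TensorProduct.rid k A).toLinearMap ∘ₗ p.lTensor A ∘ₗ comul (R := k)) ∘ₗ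
          LinearMap.mulRight k a := by
  intro p a
  ext b
  refine Module.eval_apply_injective k (LinearMap.ext fun q => ?_)
  rw [Module.Dual.eval_apply, Module.Dual.eval_apply, hE]
  set R : A →ₗ[k] A := (TensorProduct.lid k A).toLinearMap ∘ₗ q.rTensor A ∘ₗ comul (R := k)
    with hR
  have hfactor : LinearMap.mulLeft k b ∘ₗ p.smulRight a ∘ₗ R = (p ∘ₗ R).smulRight (b * a) := by
    ext c
    simp
  have hswap : p ∘ₗ (TensorProduct.lid k A).toLinearMap ∘ₗ q.rTensor A =
      q ∘ₗ (TensorProduct.rid k A).toLinearMap ∘ₗ p.lTensor A := by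
    ext x y
    simp [mul_comm]
  rw [hfactor, LinearMap.trace_smulRight]
  simpa [hR] using LinearMap.congr_fun hswap (comul (R := k) (b * a))
end

section
/- The linear map ℰ : End(A) → End(A) defined by q(ℰ(f)(a)) = tr(ℓ(a) ∘ f ∘ r(q)) for all q ∈ A*, f ∈ End(A), a ∈ A, is a linear automorphism of End(A). -/
open TensorProduct LinearMap HopfAlgebra Coalgebra

section

variable {k A M : Type*} [Field k] [Ring A] [HopfAlgebra k A] [AddCommGroup M] [Module k M]

/-- The endomorphism `c ⊗ m ↦ c₍₁₎ ⊗ ρ(c₍₂₎) m` of `A ⊗ M`. -/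
noncomputable def comulTwist (ρ : A →ₗ[k] Module.End k M) : A ⊗[k] M →ₗ[k] A ⊗[k] M :=
  (TensorProduct.lift ρ).lTensor A ∘ₗ (TensorProduct.assoc k A A M).toLinearMap ∘ₗ
    (comul (R := k)).rTensor M

lemma comulTwist_tmul (ρ : A →ₗ[k] Module.End k M) (c : A) (m : M) :
    comulTwist ρ (c ⊗ₜ m) = (ρ.flip m).lTensor A (comul (R := k) c) := by
  have h (t : A ⊗[k] A) :
      (TensorProduct.lift ρ).lTensor A (TensorProduct.assoc k A A M (t ⊗ₜ m)) =
        (ρ.flip m).lTensor A t := by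
    induction t with
    | zero => simp
    | tmul x y => simp
    | add x y hx hy => simp only [add_tmul, map_add, hx, hy]
  simpa [comulTwist] using h (comul c)

lemma comulTwist_antipode_comulTwist (ρ : A →ₐ[k] Module.End k M) (t : A ⊗[k] M) :
    comulTwist (ρ.toLinearMap ∘ₗ antipode k) (comulTwist ρ.toLinearMap t) = t := by
  induction t with
  | zero => simp
  | add x y hx hy => simp only [map_add, hx, hy]
  | tmul c m =>
    let g : A ⊗[k] A →ₗ[k] M := ρ.toLinearMap.flip m ∘ₗ mul' k A ∘ₗ (antipode k).rTensor A
    have h₁ (s : A ⊗[k] A) (z : A) :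
        ((ρ.toLinearMap ∘ₗ antipode k).flip (ρ z m)).lTensor A s =
          g.lTensor A (TensorProduct.assoc k A A A (s ⊗ₜ z)) := by
      induction s with
      | zero => simp
      | tmul x y => simp [g]
      | add x y hx hy => simp only [add_tmul, map_add, hx, hy]
    have h₂ (s : A ⊗[k] A) :
        comulTwist (ρ.toLinearMap ∘ₗ antipode k) ((ρ.toLinearMap.flip m).lTensor A s) =
          g.lTensor A (TensorProduct.assoc k A A A ((comul (R := k)).rTensor A s)) := by
      induction s with
      | zero => simp
      | tmul x y => simpa [comulTwist_tmul] using h₁ (comul x) y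
      | add x y hx hy => simp only [map_add, hx, hy]
    have h₃ : g ∘ₗ comul = ρ.toLinearMap.flip m ∘ₗ Algebra.linearMap k A ∘ₗ counit := by
      rw [← mul_antipode_rTensor_comul]
      rfl
    rw [comulTwist_tmul, h₂, coassoc_apply, ← lTensor_comp_apply, h₃, ← comp_assoc,
      lTensor_comp_apply, lTensor_counit_comul]
    simp

variable (k A) in
/-- The action of `A` on its dual by right translation, `(c • p) x = p (x * c)`. -/
noncomputable def dualRightTranslation : A →ₐ[k] Module.End k (Module.Dual k A) :=
  AlgHom.ofLinearMap (Module.Dual.transpose ∘ₗ (LinearMap.mul k A).flip)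
    (by ext; simp [Module.Dual.transpose_apply])
    (fun x y ↦ by ext; simp [Module.Dual.transpose_apply, mul_assoc])

@[simp]
lemma dualRightTranslation_apply (c x : A) (p : Module.Dual k A) :
    dualRightTranslation k A c p x = p (x * c) := rfl

/-- Convolution with the identity on the left is injective. -/
lemma mul'_comp_lTensor_comp_comul_injective :
    Function.Injective fun f : A →ₗ[k] A ↦ mul' k A ∘ₗ f.lTensor A ∘ₗ comul := by
  intro f g h
  have h' : WithConv.toConv (LinearMap.id : A →ₗ[k] A) * WithConv.toConv f =
      WithConv.toConv (LinearMap.id : A →ₗ[k] A) * WithConv.toConv g := congrArg WithConv.toConv h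
  apply WithConv.toConv_injective
  simpa [← mul_assoc] using congrArg (WithConv.toConv (antipode k (A := A)) * ·) h'

lemma trace_mulLeft_comp_dualTensorHom_comp [FiniteDimensional k A] (p : Module.Dual k A)
    (c a : A) (r : A →ₗ[k] A) :
    trace k A (mulLeft k a ∘ₗ dualTensorHom k A A (p ⊗ₜ c) ∘ₗ r) = p (r (a * c)) := by
  have h : mulLeft k a ∘ₗ dualTensorHom k A A (p ⊗ₜ c) ∘ₗ r = (p ∘ₗ r).smulRight (a * c) := by
    ext; simp
  rw [h, trace_smulRight, comp_apply]

lemma apply_lid_rTensor_mul (q p : Module.Dual k A) (s t : A ⊗[k] A) :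
    p (TensorProduct.lid k A (q.rTensor A (s * t))) =
      q (mul' k A ((dualTensorHom k A A (TensorProduct.comm k _ _
        (((dualRightTranslation k A).toLinearMap.flip p).lTensor A t))).lTensor A s)) := by
  induction s with
  | zero => simp
  | add x y hx hy => simp only [add_mul, map_add, hx, hy]
  | tmul a b =>
    induction t with
    | zero => simp
    | add x y hx hy => simp only [mul_add, map_add, hx, hy, lTensor_add, LinearMap.add_apply]
    | tmul c d => simp [mul_comm]

end

/-- Let `A` be a finite-dimensional Hopf algebra over a field `k`.  The linear
map `ℰ : End(A) → End(A)` defined by `q(ℰ(f)(a)) = tr(ℓ(a) ∘ f ∘ r(q))` for all `q ∈ A*`,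
`f ∈ End(A)`, `a ∈ A` (where `ℓ(a) b = a·b` and `r(q) b = q(b₍₁₎) • b₍₂₎`) is a linear
automorphism of `End(A)`. -/
theorem stmt15 (k A : Type*) [Field k] [Ring A] [HopfAlgebra k A] [FiniteDimensional k A]
    (E : (A →ₗ[k] A) →ₗ[k] (A →ₗ[k] A))
    (hE : ∀ (q : Module.Dual k A) (f : A →ₗ[k] A) (a : A),
      q (E f a) = LinearMap.trace k A
        (LinearMap.mulLeft k a ∘ₗ f ∘ₗ
          ((TensorProduct.lid k A).toLinearMap ∘ₗ q.rTensor A ∘ₗ comul (R := k)))) :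
    Function.Bijective E := by
  suffices h : Function.Injective E from ⟨h, LinearMap.injective_iff_surjective.1 h⟩
  let Φ : A ⊗[k] Module.Dual k A →ₗ[k] A →ₗ[k] A :=
    dualTensorHom k A A ∘ₗ (TensorProduct.comm k A (Module.Dual k A)).toLinearMap
  have hΦ : Function.Bijective Φ :=
    (dualTensorHomEquiv k A A).bijective.comp (TensorProduct.comm k _ _).bijective
  have key (t : A ⊗[k] Module.Dual k A) :
      E (Φ t) = mul' k A ∘ₗ
        (Φ (comulTwist (dualRightTranslation k A).toLinearMap t)).lTensor A ∘ₗ comul := by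
    induction t with
    | zero => simp
    | add x y hx hy => simp only [map_add, hx, hy, lTensor_add, add_comp, comp_add]
    | tmul c p =>
      ext a
      refine Module.eval_apply_injective k (LinearMap.ext fun q ↦ ?_)
      rw [Module.Dual.eval_apply, Module.Dual.eval_apply, hE, comulTwist_tmul]
      simpa [Φ, trace_mulLeft_comp_dualTensorHom_comp, Bialgebra.comul_mul] using
        apply_lid_rTensor_mul q p (comul a) (comul c)
  intro f g hfg
  obtain ⟨s, rfl⟩ := hΦ.2 f
  obtain ⟨t, rfl⟩ := hΦ.2 g
  rw [key, key] at hfg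
  have h := hΦ.1 (mul'_comp_lTensor_comp_comul_injective hfg)
  rw [← comulTwist_antipode_comulTwist (dualRightTranslation k A) s, h,
    comulTwist_antipode_comulTwist]
end

section
/- Suppose λ ∈ A* is a right integral for A*, Λ ∈ A is a left integral for A, and λ(Λ) = 1. Then tr(r(a) ∘ s² ∘ r(p)) = λ(a)·p(Λ) for all a ∈ A and p ∈ A*. -/
open TensorProduct LinearMap HopfAlgebra Coalgebra

section IntegralTrace

variable {k A : Type*} [Field k] [Ring A] [HopfAlgebra k A]

lemma sum_counit_right_smul (b : A) :
    ∑ i ∈ (ℛ k b).index, counit (R := k) ((ℛ k b).right i) • (ℛ k b).left i = b := by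
  simpa only [map_sum, TensorProduct.rid_tmul, one_smul]
    using congr(TensorProduct.rid k A $(sum_tmul_counit_eq (R := k) (ℛ k b)))

/-- Coassociativity, evaluated under a linear map out of the triple tensor product. -/
lemma sum_sum_map_comul_left_eq {M : Type*} [AddCommMonoid M] [Module k M]
    (F : A ⊗[k] (A ⊗[k] A) →ₗ[k] M) (b : A) :
    ∑ i ∈ (ℛ k b).index, ∑ j ∈ (ℛ k ((ℛ k b).left i)).index,
        F ((ℛ k ((ℛ k b).left i)).left j ⊗ₜ[k]
          ((ℛ k ((ℛ k b).left i)).right j ⊗ₜ[k] (ℛ k b).right i)) =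
      ∑ i ∈ (ℛ k b).index, ∑ j ∈ (ℛ k ((ℛ k b).right i)).index,
        F ((ℛ k b).left i ⊗ₜ[k] ((ℛ k ((ℛ k b).right i)).left j ⊗ₜ[k]
          (ℛ k ((ℛ k b).right i)).right j)) := by
  simpa only [map_sum] using congr(F $(sum_tmul_tmul_eq (ℛ k b)
    (fun i ↦ ℛ k ((ℛ k b).left i)) (fun i ↦ ℛ k ((ℛ k b).right i))))

/-- If `lam` is a right integral for the dual, then
`lam (b₍₁₎ * c) • b₍₂₎ = lam (b * c₍₁₎) • S c₍₂₎`. -/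
lemma sum_integral_mul_smul_antipode (lam : Module.Dual k A)
    (hlam : ∀ a : A,
      (TensorProduct.lid k A) (lam.rTensor A (comul (R := k) a)) = lam a • (1 : A)) (b c : A) :
    ∑ i ∈ (ℛ k c).index, lam (b * (ℛ k c).left i) • antipode k ((ℛ k c).right i) =
      ∑ i ∈ (ℛ k b).index, lam ((ℛ k b).left i * c) • (ℛ k b).right i := by
  have h₁ (x : A) : lam (b * x) • (1 : A) =
      ∑ j ∈ (ℛ k b).index, ∑ l ∈ (ℛ k x).index,
        lam ((ℛ k b).left j * (ℛ k x).left l) • ((ℛ k b).right j * (ℛ k x).right l) := by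
    rw [← hlam, Bialgebra.comul_mul, ← (ℛ k b).eq, ← (ℛ k x).eq]
    simp [Finset.sum_mul_sum]
  have h₂ (j) := sum_sum_map_comul_left_eq
    ((TensorProduct.lid k A).toLinearMap ∘ₗ
      TensorProduct.map (lam ∘ₗ mulLeft k ((ℛ k b).left j))
        (mul' k A ∘ₗ TensorProduct.map (mulLeft k ((ℛ k b).right j)) (antipode k))) c
  simp only [coe_comp, Function.comp_apply, LinearEquiv.coe_coe, TensorProduct.map_tmul,
    mulLeft_apply, mul'_apply, TensorProduct.lid_tmul] at h₂
  calc
    _ = ∑ i ∈ (ℛ k c).index, (lam (b * (ℛ k c).left i) • (1 : A)) *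
          antipode k ((ℛ k c).right i) := by simp
    _ = ∑ j ∈ (ℛ k b).index, ∑ i ∈ (ℛ k c).index, ∑ l ∈ (ℛ k ((ℛ k c).left i)).index,
          lam ((ℛ k b).left j * (ℛ k ((ℛ k c).left i)).left l) •
            ((ℛ k b).right j * (ℛ k ((ℛ k c).left i)).right l *
              antipode k ((ℛ k c).right i)) := by
      simp_rw [h₁, Finset.sum_mul, smul_mul_assoc]
      exact Finset.sum_comm
    _ = _ := by
      refine Finset.sum_congr rfl fun j _ ↦ ?_
      rw [h₂]
      simp_rw [mul_assoc ((ℛ k b).right j), ← Finset.smul_sum, ← Finset.mul_sum,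
        sum_mul_antipode_eq_smul, mul_smul_comm, mul_one, smul_comm (lam _), ← smul_assoc,
        ← Finset.sum_smul]
      congr 1
      conv_rhs => rw [← sum_counit_right_smul (k := k) c]
      simp [Finset.mul_sum]

variable {lam : Module.Dual k A} {Lam : A}

lemma sum_integral_smul_antipode_eq_self
    (hlam : ∀ a : A,
      (TensorProduct.lid k A) (lam.rTensor A (comul (R := k) a)) = lam a • (1 : A))
    (hLam : ∀ a : A, a * Lam = counit (R := k) a • Lam) (hpair : lam Lam = 1) (b : A) :
    ∑ i ∈ (ℛ k Lam).index, lam (b * (ℛ k Lam).left i) • antipode k ((ℛ k Lam).right i) = b := by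
  rw [sum_integral_mul_smul_antipode lam hlam]
  simp [hLam, hpair, sum_counit_smul]

/-- The pairing `(b, c) ↦ lam (b * c)` is nondegenerate. -/
lemma eq_zero_of_forall_integral_mul_eq_zero [FiniteDimensional k A]
    (hlam : ∀ a : A,
      (TensorProduct.lid k A) (lam.rTensor A (comul (R := k) a)) = lam a • (1 : A))
    (hLam : ∀ a : A, a * Lam = counit (R := k) a • Lam) (hpair : lam Lam = 1) {c : A}
    (hc : ∀ b, lam (b * c) = 0) : c = 0 := by
  have hinj : Function.Injective ((LinearMap.mul k A).compr₂ lam) := by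
    refine (injective_iff_map_eq_zero _).2 fun b hb ↦ ?_
    rw [← sum_integral_smul_antipode_eq_self hlam hLam hpair b]
    refine Finset.sum_eq_zero fun i _ ↦ ?_
    have := LinearMap.congr_fun hb ((ℛ k Lam).left i)
    simp only [compr₂_apply, mul_apply', LinearMap.zero_apply] at this
    rw [this, zero_smul]
  have hsurj := (injective_iff_surjective_of_finrank_eq_finrank
    (Subspace.dual_finrank_eq (K := k) (V := A)).symm).1 hinj
  refine (Module.forall_dual_apply_eq_zero_iff k c).1 fun φ ↦ ?_
  obtain ⟨b, rfl⟩ := hsurj φ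
  exact hc b

lemma sum_integral_antipode_mul_smul_eq_self [FiniteDimensional k A]
    (hlam : ∀ a : A,
      (TensorProduct.lid k A) (lam.rTensor A (comul (R := k) a)) = lam a • (1 : A))
    (hLam : ∀ a : A, a * Lam = counit (R := k) a • Lam) (hpair : lam Lam = 1) (c : A) :
    ∑ i ∈ (ℛ k Lam).index, lam (antipode k ((ℛ k Lam).right i) * c) • (ℛ k Lam).left i = c := by
  refine sub_eq_zero.1 (eq_zero_of_forall_integral_mul_eq_zero hlam hLam hpair fun b ↦ ?_)
  rw [mul_sub, map_sub, sub_eq_zero]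
  conv_rhs => rw [← sum_integral_smul_antipode_eq_self hlam hLam hpair b]
  simp [Finset.mul_sum, Finset.sum_mul, mul_comm]

/-- The trace of an endomorphism, computed with the dual bases given by a pair of integrals. -/
lemma trace_eq_sum_integral [FiniteDimensional k A]
    (hlam : ∀ a : A,
      (TensorProduct.lid k A) (lam.rTensor A (comul (R := k) a)) = lam a • (1 : A))
    (hLam : ∀ a : A, a * Lam = counit (R := k) a • Lam) (hpair : lam Lam = 1) (f : A →ₗ[k] A) :
    LinearMap.trace k A f = ∑ i ∈ (ℛ k Lam).index,
      lam (antipode k ((ℛ k Lam).right i) * f ((ℛ k Lam).left i)) := by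
  have hf : f = ∑ i ∈ (ℛ k Lam).index,
      (lam ∘ₗ mulLeft k (antipode k ((ℛ k Lam).right i))).smulRight (f ((ℛ k Lam).left i)) := by
    ext c
    conv_lhs => rw [← sum_integral_antipode_mul_smul_eq_self hlam hLam hpair c]
    simp
  conv_lhs => rw [hf]
  simp [trace_smulRight]

end IntegralTrace

/-- Let `A` be a finite-dimensional Hopf algebra over a field `k` with antipode
`s`.  Suppose `λ ∈ A*` is a right integral for `A*` (i.e. `λ(a₍₁₎) • a₍₂₎ = λ(a) • 1`),
`Λ ∈ A` is a left integral for `A` (i.e. `a·Λ = ε(a) • Λ`), and `λ(Λ) = 1`.  Then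
`tr(r(a) ∘ s² ∘ r(p)) = λ(a)·p(Λ)` for all `a ∈ A` and `p ∈ A*`, where `r(a) b = b·a` and
`r(p) b = p(b₍₁₎) • b₍₂₎`. -/
theorem stmt19 (k A : Type*) [Field k] [Ring A] [HopfAlgebra k A] [FiniteDimensional k A]
    (lam : Module.Dual k A) (Lam : A)
    (hlam : ∀ a : A,
      (TensorProduct.lid k A) (lam.rTensor A (comul (R := k) a)) = lam a • (1 : A))
    (hLam : ∀ a : A, a * Lam = counit (R := k) a • Lam)
    (hpair : lam Lam = 1) :
    ∀ (a : A) (p : Module.Dual k A),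
      LinearMap.trace k A
        (LinearMap.mulRight k a ∘ₗ antipode (R := k) ∘ₗ antipode (R := k) ∘ₗ
          ((TensorProduct.lid k A).toLinearMap ∘ₗ p.rTensor A ∘ₗ comul (R := k))) =
        lam a * p Lam := by
  intro a p
  have hassoc := sum_sum_map_comul_left_eq
    ((TensorProduct.lid k k).toLinearMap ∘ₗ TensorProduct.map p
      (lam ∘ₗ mulRight k a ∘ₗ antipode k ∘ₗ mul' k A ∘ₗ (antipode k).rTensor A)) Lam
  simp only [coe_comp, Function.comp_apply, LinearEquiv.coe_coe, TensorProduct.map_tmul,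
    rTensor_tmul, mulRight_apply, mul'_apply, TensorProduct.lid_tmul, smul_eq_mul] at hassoc
  rw [trace_eq_sum_integral hlam hLam hpair]
  trans ∑ i ∈ (ℛ k Lam).index, ∑ j ∈ (ℛ k ((ℛ k Lam).left i)).index,
    p ((ℛ k ((ℛ k Lam).left i)).left j) *
      lam (antipode k (antipode k ((ℛ k ((ℛ k Lam).left i)).right j) * (ℛ k Lam).right i) * a)
  · refine Finset.sum_congr rfl fun i _ ↦ ?_
    simp only [coe_comp, Function.comp_apply, LinearEquiv.coe_coe]
    conv_lhs => rw [← (ℛ k ((ℛ k Lam).left i)).eq]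
    simp [Finset.mul_sum, antipode_mul_antidistrib, mul_assoc]
  · rw [hassoc]
    simp_rw [← Finset.mul_sum, ← map_sum, ← Finset.sum_mul, ← map_sum, sum_antipode_mul_eq_smul]
    conv_rhs => rw [← sum_counit_right_smul (k := k) Lam]
    simp [Finset.mul_sum, mul_comm, mul_left_comm]
end
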